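/- arXiv:math/9911195 — 3 statements merged into one kernel-verified Lean document; each statement's English description precedes it below -/
import Mathlib

section
/- Let L be a positive definite integral lattice, let R = {r ∈ L : B(r, r) = 2} be its (finite) set of roots, let ρ ∈ L ⊗ ℚ be the Weyl vector of L relative to a ℚ-linear functional f with f(r) ≠ 0 for all r ∈ R, and let S(L) be the maximal cardinality of a set of pairwise orthogonal roots of L. Then S(L) + 4·B(ρ, ρ) + |R|/2 is an integer divisible by 4. -/
/-- A finite set of norm-`2` vectors of `L`, all positive for `f`, which behaves like a set of
positive roots of a simply laced root system. -/
structure IsPositiveSystem {V : Type*} [AddCommGroup V] [Module ℚ V] (L : Submodule ℤ V)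
    (B : V →ₗ[ℚ] V →ₗ[ℚ] ℚ) (f : V →ₗ[ℚ] ℚ) (P : Finset V) : Prop where
  mem : ∀ x ∈ P, x ∈ L
  norm : ∀ x ∈ P, B x x = 2
  pos : ∀ x ∈ P, 0 < f x
  pairing : ∀ x ∈ P, ∀ y ∈ P, x ≠ y → B x y = -1 ∨ B x y = 0 ∨ B x y = 1
  add_mem : ∀ x ∈ P, ∀ y ∈ P, B x y = -1 → x + y ∈ P
  sub_mem : ∀ x ∈ P, ∀ y ∈ P, B x y = 1 → x - y ∈ P ∨ y - x ∈ P

namespace IsPositiveSystem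

variable {V : Type*} [AddCommGroup V] [Module ℚ V] {L : Submodule ℤ V}
  {B : V →ₗ[ℚ] V →ₗ[ℚ] ℚ} {f : V →ₗ[ℚ] ℚ} {P : Finset V}

open scoped Classical in
lemma filter_orthogonal (hP : IsPositiveSystem L B f P) (r : V) :
    IsPositiveSystem L B f (P.filter fun x => B x r = 0) where
  mem x hx := hP.mem x (Finset.mem_filter.1 hx).1
  norm x hx := hP.norm x (Finset.mem_filter.1 hx).1
  pos x hx := hP.pos x (Finset.mem_filter.1 hx).1
  pairing x hx y hy := hP.pairing x (Finset.mem_filter.1 hx).1 y (Finset.mem_filter.1 hy).1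
  add_mem x hx y hy h := by
    rw [Finset.mem_filter] at *
    exact ⟨hP.add_mem x hx.1 y hy.1 h, by simp [hx.2, hy.2]⟩
  sub_mem x hx y hy h := by
    simp only [Finset.mem_filter] at *
    exact (hP.sub_mem x hx.1 y hy.1 h).imp (fun h => ⟨h, by simp [hx.2, hy.2]⟩)
      (fun h => ⟨h, by simp [hx.2, hy.2]⟩)

open scoped Classical in
/-- Split the positive roots according to their position relative to a positive root `r`. -/
lemma sum_eq (hP : IsPositiveSystem L B f P) {r : V} (hr : r ∈ P) {M : Type*} [AddCommMonoid M]
    (g : V → M) :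
    ∑ x ∈ P, g x = g r + ∑ x ∈ P with B x r = 0, g x
      + (∑ x ∈ P with B x r = -1, g x + ∑ x ∈ P with B x r = -1, g (x + r))
      + ∑ x ∈ P with B x r = 1 ∧ f x < f r, g x := by
  have hrr := hP.norm r hr
  have hC : ∑ x ∈ P with B x r = -1, g (x + r)
      = ∑ x ∈ P with B x r = 1 ∧ ¬ f x < f r, g x := by
    refine Finset.sum_nbij' (fun x => x + r) (fun x => x - r) ?_ ?_ ?_ ?_ ?_
    · intro x hx
      rw [Finset.mem_filter] at hx ⊢
      have := hP.pos x hx.1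
      refine ⟨hP.add_mem x hx.1 r hr hx.2, ?_, ?_⟩
      · simp only [map_add, LinearMap.add_apply, hx.2, hrr]; norm_num
      · simp only [map_add]; linarith
    · intro x hx
      rw [Finset.mem_filter] at hx ⊢
      refine ⟨(hP.sub_mem x hx.1 r hr hx.2.1).resolve_right fun h => hx.2.2 ?_, ?_⟩
      · have := hP.pos _ h
        simp only [map_sub] at this; linarith
      · simp only [map_sub, LinearMap.sub_apply, hx.2.1, hrr]; norm_num
    · intros; simp
    · intros; simp
    · intros; rfl
  have hcover : P = insert r ((P.filter fun x => B x r = 0) ∪ ((P.filter fun x => B x r = -1) ∪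
      ((P.filter fun x => B x r = 1 ∧ ¬ f x < f r) ∪
        (P.filter fun x => B x r = 1 ∧ f x < f r)))) := by
    ext x
    simp only [Finset.mem_insert, Finset.mem_union, Finset.mem_filter]
    constructor
    · intro hx
      by_cases hxr : x = r
      · exact Or.inl hxr
      · have := hP.pairing x hx r hr hxr
        tauto
    · rintro (rfl | h)
      · exact hr
      · tauto
  rw [hC]
  conv_lhs => rw [hcover]
  rw [Finset.sum_insert, Finset.sum_union, Finset.sum_union, Finset.sum_union]
  · simp only [add_assoc]
  · rw [Finset.disjoint_left]
    simp only [Finset.mem_filter]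
    tauto
  · rw [Finset.disjoint_left]
    simp only [Finset.mem_filter, Finset.mem_union]
    rintro x ⟨_, h⟩ h'
    have : B x r = 1 := by tauto
    linarith
  · rw [Finset.disjoint_left]
    simp only [Finset.mem_filter, Finset.mem_union]
    rintro x ⟨_, h⟩ h'
    have : B x r = 1 ∨ B x r = -1 := by tauto
    rcases this with h' | h' <;> linarith
  · simp only [Finset.mem_filter, Finset.mem_union, hrr]
    norm_num

open scoped Classical in
/-- The positive roots `x` for which `r - x` is also a positive root come in pairs. -/
lemma exists_card_sum_between (hP : IsPositiveSystem L B f P) (hsymm : ∀ x y : V, B x y = B y x)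
    {r : V} (hr : r ∈ P) :
    ∃ d : ℕ, (P.filter fun x => B x r = 1 ∧ f x < f r).card = 2 * d ∧
      ∑ x ∈ P with B x r = 1 ∧ f x < f r, x = (d : ℚ) • r := by
  have hrr := hP.norm r hr
  set D := P.filter fun x => B x r = 1 ∧ f x < f r with hD
  have hmaps : ∀ x ∈ D, r - x ∈ D := by
    intro x hx
    rw [hD, Finset.mem_filter] at hx ⊢
    have hfx := hP.pos x hx.1
    refine ⟨(hP.sub_mem x hx.1 r hr hx.2.1).resolve_left fun h => ?_, ?_, ?_⟩
    · have := hP.pos _ h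
      simp only [map_sub] at this; linarith
    · simp only [map_sub, LinearMap.sub_apply, hx.2.1, hrr]; norm_num
    · simp only [map_sub]; linarith
  have hcard : ∑ _x ∈ D, (1 : ZMod 2) = 0 := by
    refine Finset.sum_involution (fun x _ => r - x) (fun _ _ => by decide) ?_ hmaps
      (fun _ _ => by simp)
    intro x hx _ h
    rw [hD, Finset.mem_filter] at hx
    have h1 : B (r - x) x = B x x := by rw [h]
    simp only [map_sub, LinearMap.sub_apply, hP.norm x hx.1, hsymm r x, hx.2.1] at h1
    norm_num at h1
  rw [Finset.sum_const, nsmul_one, ZMod.natCast_eq_zero_iff] at hcard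
  obtain ⟨d, hd⟩ := hcard
  refine ⟨d, hd, ?_⟩
  have hsum : ∑ x ∈ D, x = ∑ x ∈ D, (r - x) :=
    Finset.sum_nbij' (fun x => r - x) (fun x => r - x) hmaps hmaps
      (fun _ _ => by simp) (fun _ _ => by simp) (fun _ _ => by simp)
  rw [Finset.sum_sub_distrib, Finset.sum_const, hd, eq_sub_iff_add_eq, ← two_smul ℚ,
    ← Nat.cast_smul_eq_nsmul ℚ, Nat.cast_mul, mul_smul, Nat.cast_ofNat] at hsum
  exact smul_right_injective V (two_ne_zero (α := ℚ)) hsum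

open scoped Classical in
/-- Passing to the positive roots orthogonal to `r` raises `B(2ρ, 2ρ) + |P|` by `1` modulo `4`. -/
lemma norm_sum_add_card_orthogonal (hP : IsPositiveSystem L B f P)
    (hsymm : ∀ x y : V, B x y = B y x)
    (hint : ∀ x ∈ L, ∀ y ∈ L, ∃ n : ℤ, B x y = (n : ℚ)) {r : V} (hr : r ∈ P) :
    ∃ m : ℤ, B (∑ x ∈ P, x) (∑ x ∈ P, x) + P.card + 1 =
      B (∑ x ∈ P with B x r = 0, x) (∑ x ∈ P with B x r = 0, x) +
        (P.filter fun x => B x r = 0).card + 4 * m := by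
  have hrr := hP.norm r hr
  obtain ⟨d, hd, hds⟩ := hP.exists_card_sum_between hsymm hr
  have hsum := hP.sum_eq hr (fun x => x)
  have hcard := hP.sum_eq hr (fun _ => (1 : ℚ))
  simp only [Finset.sum_const, nsmul_one, hd] at hcard
  rw [Finset.sum_add_distrib, Finset.sum_const, hds] at hsum
  set A := P.filter fun x => B x r = -1
  set w := ∑ x ∈ A, x
  set s := ∑ x ∈ P with B x r = 0, x with hs
  have hwL : w ∈ L := sum_mem fun x hx => hP.mem x (Finset.mem_filter.1 hx).1
  have hsL : s ∈ L := sum_mem fun x hx => hP.mem x (Finset.mem_filter.1 hx).1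
  have hsr : B s r = 0 := by
    rw [hs, map_sum, LinearMap.sum_apply]
    exact Finset.sum_eq_zero fun x hx => (Finset.mem_filter.1 hx).2
  obtain ⟨a, ha⟩ := hint w hwL w hwL
  obtain ⟨b, hb⟩ := hint w hwL r (hP.mem r hr)
  obtain ⟨c, hc⟩ := hint s hsL w hwL
  have hsum' : ∑ x ∈ P, x = s + (1 + A.card + d : ℚ) • r + (2 : ℚ) • w := by
    rw [hsum, ← Nat.cast_smul_eq_nsmul ℚ]
    module
  obtain ⟨t, ht⟩ : (2 : ℤ) ∣ (A.card + d) * (A.card + d + 1) :=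
    (Int.even_mul_succ_self _).two_dvd
  have ht' : ((A.card + d) * (A.card + d + 1) : ℚ) = 2 * t := by exact_mod_cast ht
  refine ⟨t + (1 + A.card + d) + a + c + (1 + A.card + d) * b, ?_⟩
  rw [hsum', hcard]
  simp only [map_add, map_smul, LinearMap.add_apply, LinearMap.smul_apply, smul_eq_mul, hrr, hsr,
    hsymm r s, hsymm r w, hsymm w s, ha, hb, hc]
  push_cast
  linear_combination 2 * ht'

open scoped Classical in
lemma norm_sum_add_card_of_maximal (hsymm : ∀ x y : V, B x y = B y x)
    (hint : ∀ x ∈ L, ∀ y ∈ L, ∃ n : ℤ, B x y = (n : ℚ)) (T : Finset V) :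
    ∀ P : Finset V, IsPositiveSystem L B f P → (∀ t ∈ T, t ∈ P ∨ -t ∈ P) →
      (∀ a ∈ T, ∀ b ∈ T, a ≠ b → B a b = 0) → (∀ x ∈ P, ∃ t ∈ T, B x t ≠ 0) →
      ∃ m : ℤ, B (∑ x ∈ P, x) (∑ x ∈ P, x) + P.card + T.card = 4 * m := by
  induction T using Finset.induction_on with
  | empty =>
    intro P _ _ _ hmax
    have : P = ∅ := Finset.eq_empty_of_forall_notMem fun x hx => by
      obtain ⟨t, ht, _⟩ := hmax x hx
      simp at ht
    exact ⟨0, by simp [this]⟩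
  | insert r T hrT ih =>
    intro P hP hTP horth hmax
    have horth' : ∀ t ∈ T, B t r = 0 := fun t ht =>
      horth t (Finset.mem_insert_of_mem ht) r (Finset.mem_insert_self _ _)
        (fun h => hrT (h ▸ ht))
    obtain ⟨m, hm⟩ := ih (P.filter fun x => B x r = 0) (hP.filter_orthogonal r)
      (fun t ht => by
        simp only [Finset.mem_filter, map_neg, LinearMap.neg_apply, horth' t ht, neg_zero,
          and_true]
        exact hTP t (Finset.mem_insert_of_mem ht))
      (fun a ha b hb => horth a (Finset.mem_insert_of_mem ha) b (Finset.mem_insert_of_mem hb))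
      (fun x hx => by
        rw [Finset.mem_filter] at hx
        obtain ⟨t, ht, hxt⟩ := hmax x hx.1
        rcases Finset.mem_insert.1 ht with rfl | ht
        · exact absurd hx.2 hxt
        · exact ⟨t, ht, hxt⟩)
    obtain ⟨k, hk⟩ : ∃ k : ℤ, B (∑ x ∈ P, x) (∑ x ∈ P, x) + P.card + 1 =
        B (∑ x ∈ P with B x r = 0, x) (∑ x ∈ P with B x r = 0, x) +
          (P.filter fun x => B x r = 0).card + 4 * k := by
      rcases hTP r (Finset.mem_insert_self _ _) with h | h
      · exact hP.norm_sum_add_card_orthogonal hsymm hint h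
      · simpa only [map_neg, neg_eq_zero] using hP.norm_sum_add_card_orthogonal hsymm hint h
    refine ⟨m + k, ?_⟩
    rw [Finset.card_insert_of_notMem hrT]
    push_cast
    linear_combination hm + hk

end IsPositiveSystem

section IntegralLattice

variable {V : Type*} [AddCommGroup V] [Module ℚ V] {L : Submodule ℤ V}
  {B : V →ₗ[ℚ] V →ₗ[ℚ] ℚ}

lemma sq_apply_le_of_mem_lattice (hsymm : ∀ x y : V, B x y = B y x)
    (hint : ∀ x ∈ L, ∀ y ∈ L, ∃ n : ℤ, B x y = (n : ℚ))
    (hpos : ∀ x ∈ L, x ≠ 0 → 0 < B x x) {x y : V} (hx : x ∈ L) (hy : y ∈ L) :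
    B x y ^ 2 ≤ B x x * B y y := by
  by_cases hy0 : y = 0
  · simp [hy0]
  obtain ⟨a, ha⟩ := hint y hy y hy
  obtain ⟨b, hb⟩ := hint x hx y hy
  have hz : a • x - b • y ∈ L := sub_mem (L.smul_mem a hx) (L.smul_mem b hy)
  have hnn : 0 ≤ B (a • x - b • y) (a • x - b • y) := by
    by_cases h : a • x - b • y = 0
    · simp [h]
    · exact (hpos _ hz h).le
  have ha0 := hpos y hy hy0
  rw [← Int.cast_smul_eq_zsmul ℚ, ← Int.cast_smul_eq_zsmul ℚ] at hnn
  simp only [map_sub, map_smul, LinearMap.sub_apply, LinearMap.smul_apply, smul_eq_mul,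
    hsymm y x, hb, ha] at hnn
  rw [ha] at ha0
  rw [ha, hb]
  have : 0 ≤ (a : ℚ) * (B x x * a - b ^ 2) := by linarith
  linarith [nonneg_of_mul_nonneg_right this ha0]

lemma finite_roots (hfg : L.FG) (hsymm : ∀ x y : V, B x y = B y x)
    (hint : ∀ x ∈ L, ∀ y ∈ L, ∃ n : ℤ, B x y = (n : ℚ))
    (hpos : ∀ x ∈ L, x ≠ 0 → 0 < B x x) : {x : V | x ∈ L ∧ B x x = 2}.Finite := by
  obtain ⟨G, hG⟩ := hfg
  have hGL : ∀ g ∈ G, g ∈ L := fun g hg => hG ▸ Submodule.subset_span hg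
  have hbox : (Set.univ.pi fun g : G =>
      ((↑) : ℤ → ℚ) '' {n : ℤ | (n : ℚ) ^ 2 ≤ 2 * B g g}).Finite := by
    refine Set.Finite.pi fun g => Set.Finite.image _ ?_
    obtain ⟨c, hc⟩ := hint g (hGL g g.2) g (hGL g g.2)
    refine (Set.finite_Icc (-(2 * c)) (2 * c)).subset fun n hn => ?_
    simp only [Set.mem_ofPred_eq, hc] at hn
    have hn' : n ^ 2 ≤ 2 * c := by exact_mod_cast hn
    constructor <;> nlinarith [Int.le_self_sq n, Int.le_self_sq (-n)]
  refine Set.Finite.of_finite_image (f := fun x (g : G) => B x g) (hbox.subset ?_) ?_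
  · rintro _ ⟨x, hx, rfl⟩ g -
    obtain ⟨n, hn⟩ := hint x hx.1 g (hGL g g.2)
    refine ⟨n, ?_, hn.symm⟩
    have := sq_apply_le_of_mem_lattice hsymm hint hpos hx.1 (hGL g g.2)
    rwa [hn, hx.2] at this
  · intro x hx y hy hxy
    have hker : L ≤ LinearMap.ker ((B (x - y)).restrictScalars ℤ) := by
      rw [← hG, Submodule.span_le]
      intro g hg
      have : B x g = B y g := congrFun hxy ⟨g, hg⟩
      simp [this]
    have hL := sub_mem hx.1 hy.1
    by_contra hne
    exact (hpos _ hL (sub_ne_zero.2 hne)).ne' (by simpa using hker hL)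

lemma apply_root_root (hsymm : ∀ x y : V, B x y = B y x)
    (hint : ∀ x ∈ L, ∀ y ∈ L, ∃ n : ℤ, B x y = (n : ℚ))
    (hpos : ∀ x ∈ L, x ≠ 0 → 0 < B x x) {x y : V} (hx : x ∈ L) (hy : y ∈ L)
    (hxx : B x x = 2) (hyy : B y y = 2) (hne : x ≠ y) (hne' : x ≠ -y) :
    B x y = -1 ∨ B x y = 0 ∨ B x y = 1 := by
  have h1 := hpos _ (sub_mem hx hy) (sub_ne_zero.2 hne)
  have h2 := hpos _ (add_mem hx hy) (fun h => hne' (eq_neg_of_add_eq_zero_left h))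
  obtain ⟨n, hn⟩ := hint x hx y hy
  simp only [map_sub, map_add, LinearMap.sub_apply, LinearMap.add_apply, hxx, hyy, hsymm y x,
    hn] at h1 h2
  have h3 : (n : ℚ) < 2 := by linarith
  have h4 : (-2 : ℚ) < n := by linarith
  have h5 : n < 2 := by exact_mod_cast h3
  have h6 : -2 < n := by exact_mod_cast h4
  rw [hn]
  interval_cases n <;> simp

lemma isPositiveSystem_of_roots (hsymm : ∀ x y : V, B x y = B y x)
    (hint : ∀ x ∈ L, ∀ y ∈ L, ∃ n : ℤ, B x y = (n : ℚ))
    (hpos : ∀ x ∈ L, x ≠ 0 → 0 < B x x) {f : V →ₗ[ℚ] ℚ}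
    (hf : ∀ x ∈ L, B x x = 2 → f x ≠ 0) {P : Finset V}
    (hP : ∀ x, x ∈ P ↔ x ∈ L ∧ B x x = 2 ∧ 0 < f x) : IsPositiveSystem L B f P where
  mem x hx := ((hP x).1 hx).1
  norm x hx := ((hP x).1 hx).2.1
  pos x hx := ((hP x).1 hx).2.2
  pairing x hx y hy hne := by
    rw [hP] at hx hy
    refine apply_root_root hsymm hint hpos hx.1 hy.1 hx.2.1 hy.2.1 hne ?_
    rintro rfl
    have := hx.2.2
    rw [map_neg] at this
    linarith [hy.2.2]
  add_mem x hx y hy h := by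
    rw [hP] at *
    refine ⟨add_mem hx.1 hy.1, ?_, ?_⟩
    · simp only [map_add, LinearMap.add_apply, hx.2.1, hy.2.1, hsymm y x, h]; norm_num
    · rw [map_add]; linarith
  sub_mem x hx y hy h := by
    rw [hP] at hx hy
    have h1 : B (x - y) (x - y) = 2 := by
      simp only [map_sub, LinearMap.sub_apply, hx.2.1, hy.2.1, hsymm y x, h]; norm_num
    have h2 : B (y - x) (y - x) = 2 := by rwa [← neg_sub x y, map_neg, map_neg, LinearMap.neg_apply, neg_neg]
    rcases (hf _ (sub_mem hx.1 hy.1) h1).lt_or_gt with h3 | h3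
    · refine Or.inr ((hP _).2 ⟨sub_mem hy.1 hx.1, h2, ?_⟩)
      rw [map_sub] at h3 ⊢; linarith
    · exact Or.inl ((hP _).2 ⟨sub_mem hx.1 hy.1, h1, h3⟩)

end IntegralLattice

/-- If `L` is a positive definite integral lattice with root set `R`, Weyl vector `ρ`
(relative to a functional nonvanishing on `R`), and `S(L)` the maximal number of pairwise
orthogonal roots, then `S(L) + 4·B(ρ,ρ) + |R|/2` is an integer divisible by 4. -/
theorem S_add_four_weyl_norm_add_half_roots_div_four
    (V : Type*) [AddCommGroup V] [Module ℚ V]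
    (L : Submodule ℤ V) (hfg : L.FG)
    (hspan : Submodule.span ℚ (L : Set V) = ⊤)
    (B : V →ₗ[ℚ] V →ₗ[ℚ] ℚ)
    (hsymm : ∀ x y : V, B x y = B y x)
    (hint : ∀ x ∈ L, ∀ y ∈ L, ∃ n : ℤ, B x y = (n : ℚ))
    (hpos : ∀ x ∈ L, x ≠ 0 → 0 < B x x)
    (f : V →ₗ[ℚ] ℚ)
    (hf : ∀ x ∈ L, B x x = 2 → f x ≠ 0)
    (ρ : V)
    (hρ : ρ = (2⁻¹ : ℚ) • ∑ᶠ x ∈ {x : V | x ∈ L ∧ B x x = 2 ∧ 0 < f x}, x)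
    (S : ℕ)
    (hS : S = sSup {k : ℕ | ∃ T : Finset V,
      (↑T : Set V) ⊆ {x : V | x ∈ L ∧ B x x = 2} ∧
      (∀ a ∈ T, ∀ b ∈ T, a ≠ b → B a b = 0) ∧ T.card = k}) :
    ∃ m : ℤ,
      (S : ℚ) + 4 * B ρ ρ + ({x : V | x ∈ L ∧ B x x = 2}.ncard : ℚ) / 2 = 4 * (m : ℚ) := by
  classical
  set R : Set V := {x : V | x ∈ L ∧ B x x = 2}
  have hRfin : R.Finite := finite_roots hfg hsymm hint hpos
  have hPfin : {x : V | x ∈ L ∧ B x x = 2 ∧ 0 < f x}.Finite :=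
    hRfin.subset fun x hx => ⟨hx.1, hx.2.1⟩
  obtain ⟨P, hPR⟩ : ∃ P : Finset V, (P : Set V) = {x : V | x ∈ L ∧ B x x = 2 ∧ 0 < f x} :=
    ⟨hPfin.toFinset, hPfin.coe_toFinset⟩
  have hP : ∀ x, x ∈ P ↔ x ∈ L ∧ B x x = 2 ∧ 0 < f x := fun x => by
    rw [← Finset.mem_coe, hPR, Set.mem_ofPred_eq]
  have hsys := isPositiveSystem_of_roots hsymm hint hpos hf hP
  have hRP : ∀ x ∈ R, x ∈ P ∨ -x ∈ P := by
    rintro x ⟨hx, hxx⟩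
    rcases (hf x hx hxx).lt_or_gt with h | h
    · exact Or.inr ((hP _).2 ⟨neg_mem hx, by simpa using hxx, by simpa using h⟩)
    · exact Or.inl ((hP _).2 ⟨hx, hxx, h⟩)
  have hcard : R.ncard = 2 * P.card := by
    have hunion : R = ((P ∪ P.image Neg.neg : Finset V) : Set V) := by
      ext x
      simp only [Finset.coe_union, Finset.coe_image, Set.mem_union, Finset.mem_coe, Set.mem_image]
      constructor
      · intro hx
        exact (hRP x hx).imp_right fun h => ⟨-x, h, neg_neg x⟩
      · rintro (hx | ⟨y, hy, rfl⟩)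
        · exact ⟨hsys.mem x hx, hsys.norm x hx⟩
        · exact ⟨neg_mem (hsys.mem y hy), by simpa using hsys.norm y hy⟩
    rw [hunion, Set.ncard_coe_finset, Finset.card_union_of_disjoint,
      Finset.card_image_of_injective _ neg_injective, two_mul]
    rw [Finset.disjoint_left]
    intro x hx hx'
    obtain ⟨y, hy, rfl⟩ := Finset.mem_image.1 hx'
    have h1 := hsys.pos _ hx
    have h2 := hsys.pos _ hy
    rw [map_neg] at h1
    linarith
  set K : Set ℕ := {k : ℕ | ∃ T : Finset V, (↑T : Set V) ⊆ R ∧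
    (∀ a ∈ T, ∀ b ∈ T, a ≠ b → B a b = 0) ∧ T.card = k}
  have hne : K.Nonempty := ⟨0, ∅, by simp⟩
  have hbdd : BddAbove K := by
    refine ⟨R.ncard, ?_⟩
    rintro _ ⟨T, hT, -, rfl⟩
    rw [← Set.ncard_coe_finset]
    exact Set.ncard_le_ncard hT hRfin
  obtain ⟨T, hTR, horth, hTcard⟩ := Nat.sSup_mem hne hbdd
  rw [← hS] at hTcard
  have hmax : ∀ x ∈ P, ∃ t ∈ T, B x t ≠ 0 := by
    intro x hx
    by_contra! h
    have hxx := hsys.norm x hx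
    have hxT : x ∉ T := fun hxT => by linarith [h x hxT]
    have hle : (insert x T).card ≤ S := by
      rw [hS]
      refine le_csSup hbdd ⟨insert x T, ?_, ?_, rfl⟩
      · rw [Finset.coe_insert]
        exact Set.insert_subset ⟨hsys.mem x hx, hxx⟩ hTR
      · intro a ha b hb hab
        rcases Finset.mem_insert.1 ha with rfl | ha' <;>
          rcases Finset.mem_insert.1 hb with rfl | hb'
        · exact absurd rfl hab
        · exact h b hb'
        · rw [hsymm]; exact h a ha'
        · exact horth a ha' b hb' hab
    rw [Finset.card_insert_of_notMem hxT] at hle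
    omega
  obtain ⟨m, hm⟩ := IsPositiveSystem.norm_sum_add_card_of_maximal hsymm hint T P hsys
    (fun t ht => hRP t (hTR ht)) horth hmax
  refine ⟨m, ?_⟩
  rw [← hPR, finsum_mem_coe_finset] at hρ
  rw [hρ, hcard, ← hTcard]
  simp only [map_smul, LinearMap.smul_apply, smul_eq_mul]
  push_cast
  linear_combination hm
end

section
/- Let N be a Niemeier lattice and let R = {r ∈ N : B(r, r) = 2} be its set of roots. Then: (a) the ℚ-linear span of R in N ⊗ ℚ has dimension 0 or 24; and (b) all components of the root system of N have the same Coxeter number, i.e. writing C(r) for the connected component of a root r in the graph on R joining two roots whenever they are not orthogonal, one has |C(r)|·dim span(C(s)) = |C(s)|·dim span(C(r)) for all roots r, s ∈ R. -/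
/-- The set of roots (norm-2 vectors) of a lattice `L` in `V`. -/
def rootSet {V : Type*} [AddCommGroup V] [Module ℚ V] (L : Submodule ℤ V)
    (B : V →ₗ[ℚ] V →ₗ[ℚ] ℚ) : Set V :=
  {x : V | x ∈ L ∧ B x x = 2}

/-- Two roots are adjacent when they are not orthogonal. -/
def rootAdj {V : Type*} [AddCommGroup V] [Module ℚ V] (L : Submodule ℤ V)
    (B : V →ₗ[ℚ] V →ₗ[ℚ] ℚ) (a b : V) : Prop :=
  a ∈ rootSet L B ∧ b ∈ rootSet L B ∧ B a b ≠ 0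

/-- The connected component of a root `r` in the graph on the roots joining two roots
whenever they are not orthogonal. -/
def rootComponent {V : Type*} [AddCommGroup V] [Module ℚ V] (L : Submodule ℤ V)
    (B : V →ₗ[ℚ] V →ₗ[ℚ] ℚ) (r : V) : Set V :=
  {s : V | s ∈ rootSet L B ∧ Relation.ReflTransGen (rootAdj L B) r s}

section ThetaSeries

open Complex
open scoped Real

theorem summable_norm_and_hasSum_pi_prod {α : Type*} {n : ℕ} (g : Fin n → α → ℂ)
    (hg : ∀ i, Summable fun a => ‖g i a‖) :
    (Summable fun a : Fin n → α => ‖∏ i, g i (a i)‖) ∧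
      HasSum (fun a : Fin n → α => ∏ i, g i (a i)) (∏ i, ∑' a, g i a) := by
  induction n with
  | zero =>
    refine ⟨Summable.of_finite, ?_⟩
    simp
  | succ n ih =>
    obtain ⟨h1, h2⟩ := ih (fun i => g i.succ) (fun i => hg i.succ)
    generalize hG : (fun a : Fin n → α => ∏ i, g i.succ (a i)) = G at h2
    have hG' (a : Fin n → α) : ∏ i, g i.succ (a i) = G a := congrFun hG a
    simp only [hG'] at h1
    have hn := Summable.mul_norm (hg 0) h1
    have hsum := (hg 0).of_norm.hasSum.mul h2 hn.of_norm
    constructor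
    · rw [← (Fin.consEquiv fun _ => α).summable_iff]
      refine hn.congr fun p => ?_
      simp [Fin.consEquiv, Fin.prod_univ_succ, hG']
    · rw [← (Fin.consEquiv fun _ => α).hasSum_iff, Fin.prod_univ_succ]
      refine hsum.congr_fun fun p => ?_
      simp [Fin.consEquiv, Fin.prod_univ_succ, hG']

/-- `a ↦ (a or 1) · exp(π i a² τ / N)`, the weight `a` being present when `ε` holds. -/
noncomputable def thetaTerm (ε : Bool) (N : ℕ) (τ : ℂ) (a : ℤ) : ℂ :=
  (if ε then (a : ℂ) else 1) * cexp (π * I * a ^ 2 * τ / N)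

theorem norm_thetaTerm (ε : Bool) (N : ℕ) (τ : ℂ) (a : ℤ) :
    ‖thetaTerm ε N τ a‖ = (if ε then |(a : ℝ)| else 1) * Real.exp (-π * a ^ 2 * τ.im / N) := by
  have : (π * I * a ^ 2 * τ / N : ℂ).re = -π * a ^ 2 * τ.im / N := by
    rw [show (π * I * a ^ 2 * τ / N : ℂ) = ((π * a ^ 2 / N : ℝ) : ℂ) * (I * τ) by push_cast; ring,
      re_ofReal_mul]
    simp
    ring
  rw [thetaTerm, norm_mul, Complex.norm_exp, this]
  cases ε <;> simp

theorem summable_norm_thetaTerm (ε : Bool) {N : ℕ} (hN : 0 < N) {τ : ℂ} (hτ : 0 < τ.im) :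
    Summable fun a : ℤ => ‖thetaTerm ε N τ a‖ := by
  have hT : 0 < τ.im / N := by positivity
  have h := summable_pow_mul_jacobiTheta₂_term_bound 0 hT (if ε then 1 else 0)
  refine h.congr fun a => ?_
  rw [norm_thetaTerm]
  have : -π * (τ.im / N * a ^ 2 - 2 * 0 * ((|a| : ℤ) : ℝ)) = -π * a ^ 2 * τ.im / N := by ring
  rw [this]
  cases ε <;> simp

theorem thetaTerm_fourier (ε : Bool) {N : ℕ} (hN : 0 < N) {τ : ℂ} (hτ : 0 < τ.im) (c : ℤ) :
    ∑' a : ℤ, cexp (2 * π * I * (a * c) / N) * thetaTerm ε N τ a =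
      1 / (-I * (τ / N)) ^ (1 / 2 : ℂ) * (if ε then τ⁻¹ else 1) *
        ∑' m : ℤ, thetaTerm ε N (-1 / τ) (m * N - c) := by
  have hN' : (N : ℂ) ≠ 0 := by exact_mod_cast hN.ne'
  have hτ0 : τ ≠ 0 := by rintro rfl; simp at hτ
  have hexp (m : ℤ) : cexp (-π * I * (c / N : ℂ) ^ 2 / (τ / N)) *
      jacobiTheta₂_term m ((c / N : ℂ) / (τ / N)) (-1 / (τ / N)) =
      cexp (π * I * ((m * N - c : ℤ) : ℂ) ^ 2 * (-1 / τ) / N) := by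
    rw [jacobiTheta₂_term, ← Complex.exp_add]
    congr 1
    push_cast
    field_simp
    ring
  have him : 0 < (τ / N).im := by
    rw [Complex.div_natCast_im]; positivity
  have him' : 0 < (-1 / (τ / N)).im := by
    rw [neg_div, neg_im, one_div, inv_im, neg_div, neg_neg]
    have : 0 < normSq (τ / N) := normSq_pos.mpr (div_ne_zero hτ0 hN')
    positivity
  cases ε
  · have h := jacobiTheta₂_functional_equation (c / N : ℂ) (τ / N)
    have hl : jacobiTheta₂ (c / N : ℂ) (τ / N) =
        ∑' a : ℤ, cexp (2 * π * I * (a * c) / N) * thetaTerm false N τ a := by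
      refine tsum_congr fun a => ?_
      simp only [thetaTerm, jacobiTheta₂_term, Bool.false_eq_true, if_false, one_mul,
        ← Complex.exp_add]
      congr 1
      ring
    rw [← hl, h, jacobiTheta₂, mul_assoc, ← tsum_mul_left]
    simp only [hexp, Bool.false_eq_true, if_false, mul_one]
    simp [thetaTerm]
  · have h := jacobiTheta₂'_functional_equation (c / N : ℂ) (τ / N)
    have hl : jacobiTheta₂' (c / N : ℂ) (τ / N) = 2 * π * I *
        ∑' a : ℤ, cexp (2 * π * I * (a * c) / N) * thetaTerm true N τ a := by
      rw [← tsum_mul_left]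
      refine tsum_congr fun a => ?_
      have : cexp (2 * π * I * a * (c / N) + π * I * a ^ 2 * (τ / N)) =
          cexp (2 * π * I * (a * c) / N) * cexp (π * I * a ^ 2 * τ / N) := by
        rw [← Complex.exp_add]
        congr 1
        ring
      simp only [thetaTerm, jacobiTheta₂'_term, jacobiTheta₂_term, if_true, this]
      ring
    have hpi : (2 * π * I : ℂ) ≠ 0 := Complex.two_pi_I_ne_zero
    apply mul_left_cancel₀ hpi
    rw [← hl, h, jacobiTheta₂, jacobiTheta₂', ← tsum_mul_left,
      ← Summable.tsum_sub ((summable_jacobiTheta₂'_term_iff _ _).2 him')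
        (((summable_jacobiTheta₂_term_iff _ _).2 him').mul_left _), ← tsum_mul_left,
      ← tsum_mul_left, ← tsum_mul_left]
    refine tsum_congr fun m => ?_
    simp only [thetaTerm, if_true, ← hexp, jacobiTheta₂'_term]
    push_cast
    field_simp

/-- The pairing `∑ aᵢcᵢ/Nᵢ`. -/
def framePair {n : ℕ} (N : Fin n → ℕ) (a c : Fin n → ℤ) : ℚ := ∑ i, (a i * c i : ℚ) / N i

/-- `H` describes an even unimodular lattice containing an orthogonal frame of norms `Nᵢ`:
its elements are the vectors of pairings with the frame. -/
structure IsEvenUnimodularFrame {n : ℕ} (N : Fin n → ℕ) (H : AddSubgroup (Fin n → ℤ)) : Prop where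
  pos : ∀ i, 0 < N i
  mem_iff : ∀ a, a ∈ H ↔ ∀ c ∈ H, ∃ k : ℤ, framePair N a c = k
  even : ∀ a ∈ H, ∃ k : ℤ, framePair N a a = 2 * k

/-- Coordinatewise reduction modulo `Nᵢ`. -/
def frameRed {n : ℕ} (N : Fin n → ℕ) : (Fin n → ℤ) →+ ((i : Fin n) → ZMod (N i)) where
  toFun a i := (a i : ZMod (N i))
  map_zero' := by ext; simp
  map_add' a b := by ext; simp

/-- The character `x ↦ exp(2πi ∑ xᵢaᵢ/Nᵢ)` of `∏ ℤ/Nᵢ`. -/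
noncomputable def frameChar {n : ℕ} (N : Fin n → ℕ) [∀ i, NeZero (N i)] (a : Fin n → ℤ) :
    AddChar ((i : Fin n) → ZMod (N i)) ℂ where
  toFun x := ∏ i, ZMod.stdAddChar (x i * (a i : ZMod (N i)))
  map_zero_eq_one' := by simp
  map_add_eq_mul' x y := by simp [add_mul, AddChar.map_add_eq_mul, Finset.prod_mul_distrib]

theorem frameChar_apply {n : ℕ} (N : Fin n → ℕ) [∀ i, NeZero (N i)] (a : Fin n → ℤ)
    (x : (i : Fin n) → ZMod (N i)) :
    frameChar N a x = ∏ i, ZMod.stdAddChar (x i * (a i : ZMod (N i))) := rfl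

theorem frameChar_red {n : ℕ} (N : Fin n → ℕ) [∀ i, NeZero (N i)] (a c : Fin n → ℤ) :
    frameChar N a (frameRed N c) = cexp (2 * π * I * framePair N a c) := by
  have h (i : Fin n) : ZMod.stdAddChar ((c i : ZMod (N i)) * (a i : ZMod (N i))) =
      cexp (2 * π * I * ((a i * c i : ℂ) / N i)) := by
    rw [← Int.cast_mul, ZMod.stdAddChar_coe]
    congr 1
    push_cast
    ring
  rw [frameChar_apply]
  simp only [frameRed, AddMonoidHom.coe_mk, ZeroHom.coe_mk, h]
  rw [← Complex.exp_sum, ← Finset.mul_sum]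
  simp [framePair]

namespace IsEvenUnimodularFrame

variable {n : ℕ} {N : Fin n → ℕ} {H : AddSubgroup (Fin n → ℤ)}

theorem mem_of_red_eq_zero (hH : IsEvenUnimodularFrame N H) {a : Fin n → ℤ}
    (ha : frameRed N a = 0) : a ∈ H := by
  rw [hH.mem_iff]
  intro c _
  have hd (i : Fin n) : ∃ k : ℤ, a i = N i * k :=
    (ZMod.intCast_zmod_eq_zero_iff_dvd _ _).1 (congrFun ha i)
  choose k hk using hd
  refine ⟨∑ i, k i * c i, ?_⟩
  rw [framePair]
  push_cast
  refine Finset.sum_congr rfl fun i _ => ?_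
  have : (N i : ℚ) ≠ 0 := by exact_mod_cast (hH.pos i).ne'
  rw [hk i]
  push_cast
  field_simp

theorem red_mem_iff (hH : IsEvenUnimodularFrame N H) (a : Fin n → ℤ) :
    frameRed N a ∈ H.map (frameRed N) ↔ a ∈ H := by
  constructor
  · rintro ⟨b, hb, hab⟩
    have : frameRed N (a - b) = 0 := by rw [map_sub, hab, sub_self]
    simpa using H.add_mem (hH.mem_of_red_eq_zero this) hb
  · exact fun ha => ⟨a, ha, rfl⟩

open Classical in
theorem sum_frameChar (hH : IsEvenUnimodularFrame N H) [∀ i, NeZero (N i)] (a : Fin n → ℤ) :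
    ∑ x : H.map (frameRed N), frameChar N a x =
      if a ∈ H then (Fintype.card (H.map (frameRed N)) : ℂ) else 0 := by
  have h := AddChar.sum_eq_ite ((frameChar N a).compAddMonoidHom (H.map (frameRed N)).subtype)
  simp only [AddChar.compAddMonoidHom_apply, AddSubgroup.coe_subtype] at h
  rw [h]
  refine if_congr ?_ rfl rfl
  rw [hH.mem_iff, AddChar.eq_zero_iff]
  have key (c : Fin n → ℤ) : frameChar N a (frameRed N c) = 1 ↔ ∃ k : ℤ, framePair N a c = k := by
    rw [frameChar_red, Complex.exp_eq_one_iff]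
    refine exists_congr fun k => ?_
    rw [mul_comm (k : ℂ), mul_right_inj' Complex.two_pi_I_ne_zero]
    norm_cast
  constructor
  · intro hψ c hc
    exact (key c).1 (hψ ⟨frameRed N c, c, hc, rfl⟩)
  · rintro hψ ⟨_, c, hc, rfl⟩
    exact (key c).2 (hψ c hc)

end IsEvenUnimodularFrame

/-- The summand of the theta series with weight `∏_{s i} aᵢ`. -/
noncomputable def frameTerm {n : ℕ} (s : Fin n → Bool) (N : Fin n → ℕ) (τ : ℂ) (a : Fin n → ℤ) :
    ℂ := ∏ i, thetaTerm (s i) (N i) τ (a i)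

/-- The theta series of `H` with weight `∏_{s i} aᵢ`. -/
noncomputable def frameTheta {n : ℕ} (s : Fin n → Bool) (N : Fin n → ℕ)
    (H : AddSubgroup (Fin n → ℤ)) (τ : ℂ) : ℂ := ∑' a : H, frameTerm s N τ a

theorem summable_norm_frameTerm {n : ℕ} (s : Fin n → Bool) {N : Fin n → ℕ} (hN : ∀ i, 0 < N i)
    {τ : ℂ} (hτ : 0 < τ.im) : Summable fun a : Fin n → ℤ => ‖frameTerm s N τ a‖ :=
  (summable_norm_and_hasSum_pi_prod (fun i => thetaTerm (s i) (N i) τ)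
    fun i => summable_norm_thetaTerm _ (hN i) hτ).1

namespace IsEvenUnimodularFrame

variable {n : ℕ} {N : Fin n → ℕ} {H : AddSubgroup (Fin n → ℤ)}

/-- The lattice is the union of translates of the multiples of the frame. -/
theorem bijective_translate (hH : IsEvenUnimodularFrame N H) [∀ i, NeZero (N i)] :
    ∃ e : H.map (frameRed N) × (Fin n → ℤ) ≃ H,
      ∀ p i, (e p : Fin n → ℤ) i = p.2 i * N i - ((p.1 : (i : Fin n) → ZMod (N i)) i).val := by
  let f : H.map (frameRed N) × (Fin n → ℤ) → Fin n → ℤ := fun p i =>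
    p.2 i * N i - ((p.1 : (i : Fin n) → ZMod (N i)) i).val
  have hred (p) : frameRed N (f p) = -p.1 := by
    ext i
    simp [frameRed, f]
  have hf (p) : f p ∈ H := by
    rw [← hH.red_mem_iff, hred]
    exact neg_mem p.1.2
  refine ⟨Equiv.ofBijective (fun p => (⟨f p, hf p⟩ : H)) ⟨?_, ?_⟩, fun p i => rfl⟩
  · rintro ⟨x, m⟩ ⟨y, k⟩ hxy
    have hf : f (x, m) = f (y, k) := congrArg Subtype.val hxy
    have h1 : x = y := by
      have := hred (x, m)
      rw [hf, hred] at this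
      exact Subtype.ext (neg_injective this.symm)
    subst h1
    refine Prod.ext rfl (funext fun i => ?_)
    have h2 := congrFun hf i
    have h3 : (N i : ℤ) ≠ 0 := by exact_mod_cast (hH.pos i).ne'
    simpa [f, h3, NeZero.ne] using h2
  · rintro ⟨a, ha⟩
    have hx : -frameRed N a ∈ H.map (frameRed N) := neg_mem ((hH.red_mem_iff a).2 ha)
    have hd (i : Fin n) : ∃ k : ℤ, a i + ((-frameRed N a) i).val = N i * k := by
      refine (ZMod.intCast_zmod_eq_zero_iff_dvd _ _).1 ?_
      simp [frameRed]
    choose k hk using hd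
    refine ⟨(⟨_, hx⟩, k), Subtype.ext (funext fun i => ?_)⟩
    change k i * N i - (((-frameRed N a) i).val : ℤ) = a i
    rw [mul_comm, ← hk i]
    ring

end IsEvenUnimodularFrame

namespace IsEvenUnimodularFrame

section Transform

variable {n : ℕ} {N : Fin n → ℕ} {H : AddSubgroup (Fin n → ℤ)}

theorem exists_card_mul_frameTheta (hH : IsEvenUnimodularFrame N H) :
    ∃ k : ℕ, 0 < k ∧ ∀ (s : Fin n → Bool) {τ : ℂ}, 0 < τ.im →
      k * frameTheta s N H τ =
        (∏ i, (1 / (-I * (τ / N i)) ^ (1 / 2 : ℂ) * if s i then τ⁻¹ else 1)) *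
          frameTheta s N H (-1 / τ) := by
  classical
  have (i : Fin n) : NeZero (N i) := ⟨(hH.pos i).ne'⟩
  refine ⟨Fintype.card (H.map (frameRed N)), Fintype.card_pos, fun s τ hτ => ?_⟩
  have hτ' : 0 < (-1 / τ).im := by
    have hτ0 : τ ≠ 0 := by rintro rfl; simp at hτ
    rw [neg_div, neg_im, one_div, inv_im, neg_div, neg_neg]
    have : 0 < normSq τ := normSq_pos.mpr hτ0
    positivity
  obtain ⟨e, he⟩ := hH.bijective_translate
  have hs := summable_norm_frameTerm s hH.pos hτ
  have hs' := summable_norm_frameTerm s hH.pos hτ'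
  have hleft (x : H.map (frameRed N)) :
      (Summable fun a : Fin n → ℤ => frameChar N a x * frameTerm s N τ a) ∧
      ∑' a : Fin n → ℤ, frameChar N a x * frameTerm s N τ a =
        (∏ i, (1 / (-I * (τ / N i)) ^ (1 / 2 : ℂ) * if s i then τ⁻¹ else 1)) *
          ∑' m : Fin n → ℤ, frameTerm s N (-1 / τ) (e (x, m)) := by
    set c : Fin n → ℤ := fun i => ((x : (i : Fin n) → ZMod (N i)) i).val with hc
    have hchar (a : Fin n → ℤ) : frameChar N a x * frameTerm s N τ a =
        ∏ i, cexp (2 * π * I * (a i * c i) / N i) * thetaTerm (s i) (N i) τ (a i) := by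
      rw [Finset.prod_mul_distrib, frameTerm, frameChar_apply]
      congr 1
      refine Finset.prod_congr rfl fun i _ => ?_
      have : (x : (i : Fin n) → ZMod (N i)) i * (a i : ZMod (N i)) = ((a i * c i : ℤ) : ZMod (N i)) := by
        simp [hc, mul_comm]
      rw [this, ZMod.stdAddChar_coe]
      push_cast
      rfl
    have hnorm (i : Fin n) (a : ℤ) : ‖cexp (2 * π * I * (a * c i) / N i) *
        thetaTerm (s i) (N i) τ a‖ = ‖thetaTerm (s i) (N i) τ a‖ := by
      rw [norm_mul, show (2 * π * I * (a * c i) / N i : ℂ) =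
        ((2 * π * (a * c i) / N i : ℝ) : ℂ) * I by push_cast; ring, norm_exp_ofReal_mul_I, one_mul]
    have h1 := summable_norm_and_hasSum_pi_prod
      (fun i (a : ℤ) => cexp (2 * π * I * (a * c i) / N i) * thetaTerm (s i) (N i) τ a)
      (fun i => by simpa only [hnorm] using summable_norm_thetaTerm (s i) (hH.pos i) hτ)
    have hinj (i : Fin n) : Function.Injective fun m : ℤ => m * N i - c i := by
      intro m k hmk
      have h3 : (N i : ℤ) ≠ 0 := by exact_mod_cast (hH.pos i).ne'
      simpa [h3, (hH.pos i).ne'] using hmk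
    have h2 := summable_norm_and_hasSum_pi_prod
      (fun i (m : ℤ) => thetaTerm (s i) (N i) (-1 / τ) (m * N i - c i))
      (fun i => (summable_norm_thetaTerm (s i) (hH.pos i) hτ').comp_injective (hinj i))
    simp only [hchar]
    simp only [frameTerm, he]
    refine ⟨h1.1.of_norm, ?_⟩
    rw [h1.2.tsum_eq, h2.2.tsum_eq, ← Finset.prod_mul_distrib]
    exact Finset.prod_congr rfl fun i _ => thetaTerm_fourier (s i) (hH.pos i) hτ (c i)
  have hse : Summable fun p => frameTerm s N (-1 / τ) (e p) :=
    (e.summable_iff (f := fun a : H => frameTerm s N (-1 / τ) a)).2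
      (hs'.of_norm.comp_injective Subtype.val_injective)
  calc (Fintype.card (H.map (frameRed N)) : ℂ) * frameTheta s N H τ
      = ∑' a : Fin n → ℤ, ∑ x : H.map (frameRed N), frameChar N a x * frameTerm s N τ a := by
        rw [frameTheta, ← tsum_mul_left]
        refine (tsum_subtype (H : Set (Fin n → ℤ))
          (fun a => (Fintype.card (H.map (frameRed N)) : ℂ) * frameTerm s N τ a)).trans ?_
        refine tsum_congr fun a => ?_
        rw [← Finset.sum_mul, hH.sum_frameChar, Set.indicator_apply]
        simp only [SetLike.mem_coe, ite_mul, zero_mul]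
    _ = ∑ x : H.map (frameRed N), ∑' a : Fin n → ℤ, frameChar N a x * frameTerm s N τ a :=
        Summable.tsum_finsetSum fun x _ => (hleft x).1
    _ = (∏ i, (1 / (-I * (τ / N i)) ^ (1 / 2 : ℂ) * if s i then τ⁻¹ else 1)) *
          ∑ x : H.map (frameRed N), ∑' m : Fin n → ℤ, frameTerm s N (-1 / τ) (e (x, m)) := by
        rw [Finset.mul_sum]
        exact Finset.sum_congr rfl fun x _ => (hleft x).2
    _ = _ := by
        rw [frameTheta, ← e.tsum_eq (fun a : H => frameTerm s N (-1 / τ) a), hse.tsum_prod,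
          tsum_fintype]

end Transform

section Rank24

variable {N : Fin 24 → ℕ} {H : AddSubgroup (Fin 24 → ℤ)}

theorem frameTheta_zero_I_ne_zero {n : ℕ} {N : Fin n → ℕ} {H : AddSubgroup (Fin n → ℤ)}
    (hH : IsEvenUnimodularFrame N H) : frameTheta (fun _ => false) N H I ≠ 0 := by
  have hterm (a : Fin n → ℤ) : frameTerm (fun _ => false) N I a =
      ((∏ i, Real.exp (-(π * a i ^ 2 / N i)) : ℝ) : ℂ) := by
    rw [frameTerm]
    push_cast
    refine Finset.prod_congr rfl fun i _ => ?_
    simp only [thetaTerm, Bool.false_eq_true, if_false, one_mul]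
    congr 1
    rw [show (π * I * a i ^ 2 * I / N i : ℂ) = π * a i ^ 2 / N i * (I * I) by ring, I_mul_I]
    ring
  have hs := (summable_norm_frameTerm (fun _ => false) hH.pos (τ := I) (by simp)).of_norm
  have hs' : Summable fun a : H => frameTerm (fun _ => false) N I a :=
    hs.comp_injective Subtype.val_injective
  simp only [hterm] at hs'
  rw [Complex.summable_ofReal] at hs'
  rw [frameTheta]
  simp only [hterm]
  rw [← Complex.ofReal_tsum, Complex.ofReal_ne_zero]
  exact (hs'.tsum_pos (fun a => by positivity) 0 (by positivity)).ne'

theorem frameTheta_neg_one_div (hH : IsEvenUnimodularFrame N H) (s : Fin 24 → Bool) {τ : ℂ}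
    (hτ : 0 < τ.im) :
    frameTheta s N H τ =
      (τ ^ 12)⁻¹ * (∏ i, if s i then τ⁻¹ else 1) * frameTheta s N H (-1 / τ) := by
  obtain ⟨k, hk, h⟩ := hH.exists_card_mul_frameTheta
  set D : ℂ := ∏ i, (((N i : ℝ)⁻¹ : ℝ) : ℂ) ^ (1 / 2 : ℂ) with hD
  have hprod (τ : ℂ) (h0τ : τ ≠ 0) (s : Fin 24 → Bool) :
      ∏ i, (1 / (-I * (τ / N i)) ^ (1 / 2 : ℂ) * if s i then τ⁻¹ else 1) =
        D⁻¹ * ((τ ^ 12)⁻¹ * ∏ i, if s i then τ⁻¹ else 1) := by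
    have hi (i : Fin 24) : (-I * (τ / N i)) ^ (1 / 2 : ℂ) =
        (((N i : ℝ)⁻¹ : ℝ) : ℂ) ^ (1 / 2 : ℂ) * (-I * τ) ^ (1 / 2 : ℂ) := by
      rw [show -I * (τ / N i) = (((N i : ℝ)⁻¹ : ℝ) : ℂ) * (-I * τ) by push_cast; ring]
      have hinv : 0 < (N i : ℝ)⁻¹ := by
        have := hH.pos i
        positivity
      have h0 : (((N i : ℝ)⁻¹ : ℝ) : ℂ) ≠ 0 := Complex.ofReal_ne_zero.2 hinv.ne'
      have hτ0 : -I * τ ≠ 0 := mul_ne_zero (neg_ne_zero.2 I_ne_zero) h0τ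
      rw [Complex.cpow_def_of_ne_zero (mul_ne_zero h0 hτ0), Complex.cpow_def_of_ne_zero h0,
        Complex.cpow_def_of_ne_zero hτ0, Complex.log_ofReal_mul hinv hτ0, ← Complex.exp_add,
        Complex.ofReal_log hinv.le]
      ring_nf
    have h24 : ((-I * τ) ^ (1 / 2 : ℂ)) ^ 24 = τ ^ 12 := by
      rw [show (24 : ℕ) = 2 * 12 from rfl, pow_mul, ← Complex.cpow_nat_mul]
      norm_num [mul_pow, neg_pow]
      rw [show (12 : ℕ) = 4 * 3 from rfl, pow_mul I, I_pow_four]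
      simp
    rw [Finset.prod_mul_distrib, ← mul_assoc]
    congr 1
    simp only [hi, hD, ← h24]
    simp only [Finset.prod_mul_distrib, one_div, mul_inv, Finset.prod_inv_distrib,
      Finset.prod_const, Finset.card_univ, Fintype.card_fin, mul_comm]
  have hk' : (k : ℂ) ≠ 0 := by exact_mod_cast hk.ne'
  have hI := h (fun _ => false) (τ := I) (by simp)
  rw [hprod _ I_ne_zero] at hI
  have h12 : I ^ 12 = 1 := by rw [show (12 : ℕ) = 4 * 3 from rfl, pow_mul, I_pow_four, one_pow]
  have hdiv : -1 / I = I := by rw [div_I]; simp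
  simp only [Bool.false_eq_true, if_false, Finset.prod_const_one, h12, hdiv, inv_one,
    mul_one] at hI
  have hkD : (k : ℂ) = D⁻¹ := mul_right_cancel₀ hH.frameTheta_zero_I_ne_zero hI
  have := h s hτ
  rw [hprod _ (by rintro rfl; simp at hτ), ← hkD, mul_assoc] at this
  exact mul_left_cancel₀ hk' this

end Rank24

end IsEvenUnimodularFrame

theorem frameTerm_eq {n : ℕ} (s : Fin n → Bool) (N : Fin n → ℕ) (τ : ℂ) (a : Fin n → ℤ) :
    frameTerm s N τ a =
      (∏ i, if s i then (a i : ℂ) else 1) * cexp (π * I * framePair N a a * τ) := by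
  simp only [frameTerm, thetaTerm, Finset.prod_mul_distrib]
  rw [← Complex.exp_sum]
  congr 2
  rw [framePair]
  push_cast
  rw [Finset.mul_sum, Finset.sum_mul]
  exact Finset.sum_congr rfl fun i _ => by ring

theorem norm_frameTerm {n : ℕ} (s : Fin n → Bool) (N : Fin n → ℕ) (τ : ℂ) (a : Fin n → ℤ) :
    ‖frameTerm s N τ a‖ = ‖∏ i, if s i then (a i : ℂ) else 1‖ *
      Real.exp (-(π * framePair N a a * τ.im)) := by
  rw [frameTerm_eq, norm_mul, Complex.norm_exp,
    show (π * I * framePair N a a * τ : ℂ) = ((π * framePair N a a : ℝ) : ℂ) * (I * τ) by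
      push_cast; ring, re_ofReal_mul]
  simp

theorem framePair_self_nonneg {n : ℕ} (N : Fin n → ℕ) (a : Fin n → ℤ) : 0 ≤ framePair N a a := by
  refine Finset.sum_nonneg fun i _ => ?_
  have := mul_self_nonneg (a i : ℚ)
  positivity

theorem norm_frameTerm_le {n : ℕ} (s : Fin n → Bool) (N : Fin n → ℕ) {τ τ' : ℂ}
    (h : τ'.im ≤ τ.im) (a : Fin n → ℤ) : ‖frameTerm s N τ a‖ ≤ ‖frameTerm s N τ' a‖ := by
  rw [norm_frameTerm, norm_frameTerm]
  have : (0 : ℝ) ≤ framePair N a a := by exact_mod_cast framePair_self_nonneg N a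
  gcongr

theorem framePair_self_pos {n : ℕ} {N : Fin n → ℕ} (hN : ∀ i, 0 < N i) {a : Fin n → ℤ}
    (ha : a ≠ 0) : 0 < framePair N a a := by
  obtain ⟨i, hi⟩ := Function.ne_iff.1 ha
  refine Finset.sum_pos' (fun j _ => ?_) ⟨i, Finset.mem_univ i, ?_⟩
  · have := mul_self_nonneg (a j : ℚ)
    positivity
  · have h1 : (a i : ℚ) ≠ 0 := by exact_mod_cast hi
    have := mul_self_pos.2 h1
    have := hN i
    positivity

namespace IsEvenUnimodularFrame

open UpperHalfPlane hiding I
open ModularGroup Filter Topology MatrixGroups ModularForm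

theorem two_le_framePair_self {n : ℕ} {N : Fin n → ℕ} {H : AddSubgroup (Fin n → ℤ)}
    (hH : IsEvenUnimodularFrame N H) {a : Fin n → ℤ} (haH : a ∈ H) (ha : a ≠ 0) :
    2 ≤ framePair N a a := by
  have h0 := framePair_self_pos hH.pos ha
  obtain ⟨k, hk⟩ := hH.even a haH
  rw [hk] at h0 ⊢
  have h1 : 0 < k := by
    have : (0 : ℚ) < k := by linarith
    exact_mod_cast this
  have h2 : (1 : ℚ) ≤ k := by exact_mod_cast h1
  linarith

theorem summable_norm_subtype {n : ℕ} {N : Fin n → ℕ} {H : AddSubgroup (Fin n → ℤ)}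
    (hH : IsEvenUnimodularFrame N H) (s : Fin n → Bool) {τ : ℂ} (hτ : 0 < τ.im) :
    Summable fun a : H => ‖frameTerm s N τ a‖ :=
  (summable_norm_frameTerm s hH.pos hτ).comp_injective Subtype.val_injective

theorem differentiableOn_frameTheta {n : ℕ} {N : Fin n → ℕ} {H : AddSubgroup (Fin n → ℤ)}
    (hH : IsEvenUnimodularFrame N H) (s : Fin n → Bool) :
    DifferentiableOn ℂ (frameTheta s N H) {z | 0 < z.im} := by
  intro z hz
  obtain ⟨T, hT, hTz⟩ := exists_between (show 0 < z.im from hz)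
  have hU : IsOpen {w : ℂ | T < w.im} := isOpen_lt continuous_const continuous_im
  have hd : DifferentiableOn ℂ (fun w => ∑' a : H, frameTerm s N w a) {w : ℂ | T < w.im} := by
    refine differentiableOn_tsum_of_summable_norm
      (hH.summable_norm_subtype s (τ := T * I) (by simpa using hT)) (fun a => ?_) hU
      fun a w hw => norm_frameTerm_le s N (by simpa using (show T < w.im from hw).le) a
    simp only [frameTerm_eq]
    fun_prop
  exact (hd.differentiableAt (hU.mem_nhds hTz)).differentiableWithinAt

theorem frameTheta_add_one {n : ℕ} {N : Fin n → ℕ} {H : AddSubgroup (Fin n → ℤ)}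
    (hH : IsEvenUnimodularFrame N H) (s : Fin n → Bool) (τ : ℂ) :
    frameTheta s N H (1 + τ) = frameTheta s N H τ := by
  refine tsum_congr fun a => ?_
  obtain ⟨k, hk⟩ := hH.even a a.2
  rw [frameTerm_eq, frameTerm_eq, mul_add, Complex.exp_add, hk]
  have : cexp (π * I * ((2 * k : ℚ) : ℂ) * 1) = 1 := by
    rw [Complex.exp_eq_one_iff]
    exact ⟨k, by push_cast; ring⟩
  rw [this, one_mul]

theorem frameTheta_isZeroAtImInfty {n : ℕ} {N : Fin n → ℕ} {H : AddSubgroup (Fin n → ℤ)}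
    (hH : IsEvenUnimodularFrame N H) {s : Fin n → Bool} {i : Fin n} (hi : s i = true) :
    IsZeroAtImInfty fun τ : ℍ => frameTheta s N H τ := by
  have h := tendsto_tsum_of_dominated_convergence (𝓕 := atImInfty)
    (f := fun (τ : ℍ) (a : H) => frameTerm s N τ a) (g := fun _ => 0)
    (hH.summable_norm_subtype s (τ := I) (by simp)) (fun a => ?_) ?_
  · simpa [IsZeroAtImInfty, ZeroAtFilter, frameTheta] using h
  · rw [tendsto_zero_iff_norm_tendsto_zero]
    simp only [norm_frameTerm]
    by_cases ha : (a : Fin n → ℤ) = 0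
    · have : ∏ j, (if s j then ((a : Fin n → ℤ) j : ℂ) else 1) = 0 :=
        Finset.prod_eq_zero (Finset.mem_univ i) (by simp [hi, ha])
      simp [this]
    · have hpos : (0 : ℝ) < framePair N a a := by
        exact_mod_cast framePair_self_pos hH.pos ha
      rw [← mul_zero ‖∏ j, (if s j then ((a : Fin n → ℤ) j : ℂ) else 1)‖]
      refine Tendsto.const_mul _ ?_
      refine Real.tendsto_exp_neg_atTop_nhds_zero.comp ?_
      have : Tendsto (fun τ : ℍ => (τ : ℂ).im) atImInfty atTop := tendsto_comap
      exact this.const_mul_atTop (by positivity)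
  · filter_upwards [(atImInfty_mem _).2 ⟨1, fun z hz => hz⟩] with τ hτ a
    exact norm_frameTerm_le s N (by simpa using show 1 ≤ τ.im from hτ) a

variable {N : Fin 24 → ℕ} {H : AddSubgroup (Fin 24 → ℤ)}

theorem prod_ite_pair {i j : Fin 24} (hij : i ≠ j) (f : Fin 24 → ℂ) :
    (∏ k, if (decide (k = i ∨ k = j)) = true then f k else 1) = f i * f j := by
  rw [← Finset.prod_pair hij, ← Finset.prod_filter]
  refine Finset.prod_congr ?_ fun _ _ => rfl
  ext k
  simp

theorem frameTheta_pair_eq_zero (hH : IsEvenUnimodularFrame N H) {i j : Fin 24} (hij : i ≠ j)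
    (τ : ℍ) : frameTheta (fun k => decide (k = i ∨ k = j)) N H τ = 0 := by
  set s : Fin 24 → Bool := fun k => decide (k = i ∨ k = j) with hs
  set f : ℍ → ℂ := fun τ => frameTheta s N H τ with hf
  have hS : f ∣[(14 : ℤ)] S = f := by
    ext τ
    rw [SlashInvariantForm.slash_S_apply]
    have h := hH.frameTheta_neg_one_div s τ.im_pos
    rw [prod_ite_pair hij (fun _ => (τ : ℂ)⁻¹)] at h
    simp only [hf]
    change frameTheta s N H (-(τ : ℂ))⁻¹ * _ = _
    rw [h]
    rw [show -1 / (τ : ℂ) = (-(τ : ℂ))⁻¹ by rw [neg_div, one_div, inv_neg]]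
    have h0 : (τ : ℂ) ≠ 0 := τ.ne_zero
    rw [zpow_neg, show (14 : ℤ) = ((14 : ℕ) : ℤ) from rfl, zpow_natCast]
    field_simp
  have hT : f ∣[(14 : ℤ)] T = f := by
    ext τ
    rw [ModularForm.SL_slash_apply, modular_T_smul]
    rw [ModularGroup.denom_apply]
    simp [hf, T, hH.frameTheta_add_one]
  have hγ := SlashInvariantForm.slash_action_generators_SL2Z hS hT
  let F : CuspForm 𝒮ℒ 14 :=
    { toFun := f
      slash_action_eq' := fun A hA => by
        obtain ⟨A, rfl⟩ := hA
        exact hγ A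
      holo' := by
        rw [UpperHalfPlane.mdifferentiable_iff]
        refine (hH.differentiableOn_frameTheta s).congr fun z hz => ?_
        simp [hf, ofComplex_apply_of_im_pos hz]
      zero_at_cusps' := fun hc => by
        rw [Subgroup.IsArithmetic.isCusp_iff_isCusp_SL2Z] at hc
        rw [OnePoint.isZeroAt_iff_forall_SL2Z hc]
        intro γ _
        rw [hγ]
        exact hH.frameTheta_isZeroAtImInfty (i := i) (by simp [hs]) }
  have hF : F = 0 := by
    have h0 : Module.rank ℂ (CuspForm 𝒮ℒ 14) = 0 :=
      CuspForm.discriminantEquiv.rank_eq.trans ModularForm.levelOne_weight_two_rank_zero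
    exact rank_zero_iff_forall_zero.1 h0 F
  exact DFunLike.congr_fun hF τ

theorem finite_framePair_self_eq {n : ℕ} {N : Fin n → ℕ} {H : AddSubgroup (Fin n → ℤ)}
    (hH : IsEvenUnimodularFrame N H) (m : ℚ) : {a : Fin n → ℤ | framePair N a a = m}.Finite := by
  have h := (summable_norm_frameTerm (fun _ => false) hH.pos (τ := I) (by simp)).tendsto_cofinite_zero
  have h2 := h.eventually (gt_mem_nhds (Real.exp_pos (-(π * m))))
  refine (Filter.eventually_cofinite.1 h2).subset fun a ha => ?_
  simp only [norm_frameTerm]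
  simp [show framePair N a a = m from ha]

theorem tsum_norm_two_mul_eq_zero (hH : IsEvenUnimodularFrame N H) {i j : Fin 24} (hij : i ≠ j) :
    ∑' a : H, (if framePair N a a = 2 then
      (((a : Fin 24 → ℤ) i : ℂ) * ((a : Fin 24 → ℤ) j : ℂ)) else 0) = 0 := by
  set s : Fin 24 → Bool := fun k => decide (k = i ∨ k = j) with hs
  have hterm (t : ℝ) (a : H) : (Real.exp (2 * π * t) : ℂ) * frameTerm s N (t * I) a =
      (((a : Fin 24 → ℤ) i : ℂ) * ((a : Fin 24 → ℤ) j : ℂ)) *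
        (Real.exp (-(π * (framePair N a a - 2) * t)) : ℝ) := by
    rw [frameTerm_eq, prod_ite_pair hij (fun k => ((a : Fin 24 → ℤ) k : ℂ)), mul_left_comm]
    congr 1
    push_cast
    rw [← Complex.exp_add]
    congr 1
    rw [show (π * I * framePair N a a * (t * I) : ℂ) = π * framePair N a a * t * (I * I) by ring,
      I_mul_I]
    ring
  have h := tendsto_tsum_of_dominated_convergence (𝓕 := atTop)
    (f := fun (t : ℝ) (a : H) => (Real.exp (2 * π * t) : ℂ) * frameTerm s N (t * I) a)
    (g := fun a : H => if framePair N a a = 2 then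
      (((a : Fin 24 → ℤ) i : ℂ) * ((a : Fin 24 → ℤ) j : ℂ)) else 0)
    ((hH.summable_norm_subtype s (τ := I) (by simp)).mul_left (Real.exp (2 * π))) (fun a => ?_) ?_
  · refine tendsto_nhds_unique h ((tendsto_const_nhds (x := (0 : ℂ))).congr' ?_)
    filter_upwards [eventually_gt_atTop 0] with t ht
    rw [tsum_mul_left]
    have := hH.frameTheta_pair_eq_zero hij ⟨t * I, by simpa using ht⟩
    change frameTheta s N H (t * I) = 0 at this
    rw [frameTheta] at this
    rw [this, mul_zero]
  · simp only [hterm]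
    split_ifs with h2
    · simp [h2]
    by_cases ha : (a : Fin 24 → ℤ) = 0
    · simp [ha]
    · have h3 : (0 : ℝ) < framePair N a a - 2 := by
        have := lt_of_le_of_ne (hH.two_le_framePair_self a.2 ha) (Ne.symm h2)
        have h4 : ((2 : ℚ) : ℝ) < framePair N a a := Rat.cast_lt.2 this
        push_cast at h4
        linarith
      have h5 : Tendsto (fun t : ℝ => Real.exp (-(π * (framePair N a a - 2) * t))) atTop (𝓝 0) :=
        Real.tendsto_exp_neg_atTop_nhds_zero.comp
          (tendsto_id.const_mul_atTop (by positivity))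
      have h6 := (Complex.continuous_ofReal.tendsto 0).comp h5
      simpa using h6.const_mul (((a : Fin 24 → ℤ) i : ℂ) * ((a : Fin 24 → ℤ) j : ℂ))
  · filter_upwards [eventually_ge_atTop 1] with t ht a
    by_cases ha : (a : Fin 24 → ℤ) = 0
    · rw [hterm]
      simp only [ha, Pi.zero_apply, Int.cast_zero, zero_mul, norm_zero]
      positivity
    have h3 : (0 : ℝ) ≤ framePair N a a - 2 := by
      have h4 : ((2 : ℚ) : ℝ) ≤ framePair N a a :=
        Rat.cast_le.2 (hH.two_le_framePair_self a.2 ha)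
      push_cast at h4
      linarith
    have h1 := hterm 1 a
    simp only [ofReal_one, one_mul, mul_one] at h1
    have h1' : Real.exp (2 * π) * ‖frameTerm s N I a‖ =
        ‖(Real.exp (2 * π) : ℂ) * frameTerm s N I a‖ := by
      rw [norm_mul, Complex.norm_real, Real.norm_of_nonneg (Real.exp_pos _).le]
    rw [h1', h1, hterm]
    generalize ((a : Fin 24 → ℤ) i : ℂ) * ((a : Fin 24 → ℤ) j : ℂ) = w
    rw [norm_mul, norm_mul w, Complex.norm_real, Complex.norm_real,
      Real.norm_of_nonneg (Real.exp_pos _).le, Real.norm_of_nonneg (Real.exp_pos _).le]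
    have : 0 ≤ π * (framePair N a a - 2 : ℝ) := by positivity
    refine mul_le_mul_of_nonneg_left (Real.exp_le_exp.2 ?_) (norm_nonneg w)
    nlinarith

end IsEvenUnimodularFrame

end ThetaSeries

/-- Orthogonal nonzero vectors of a positive definite form are linearly independent. -/
theorem linearIndependent_of_orthogonal {V ι : Type*} [AddCommGroup V] [Module ℚ V]
    {B : V →ₗ[ℚ] V →ₗ[ℚ] ℚ} (hpos : ∀ v, v ≠ 0 → 0 < B v v) {e : ι → V} (h0 : ∀ i, e i ≠ 0)
    (ho : ∀ i j, i ≠ j → B (e i) (e j) = 0) : LinearIndependent ℚ e :=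
  LinearMap.BilinForm.linearIndependent_of_iIsOrtho (B := B) (fun i j hij => ho i j hij)
    fun i => (hpos _ (h0 i)).ne'

theorem span_range_eq_of_orthogonal {V ι : Type*} [AddCommGroup V] [Module ℚ V] [Fintype ι]
    {B : V →ₗ[ℚ] V →ₗ[ℚ] ℚ} (hpos : ∀ v, v ≠ 0 → 0 < B v v) {e : ι → V} (h0 : ∀ i, e i ≠ 0)
    (ho : ∀ i j, i ≠ j → B (e i) (e j) = 0) {W : Submodule ℚ V} [FiniteDimensional ℚ W]
    (heW : ∀ i, e i ∈ W) (hc : Fintype.card ι = Module.finrank ℚ W) :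
    Submodule.span ℚ (Set.range e) = W := by
  refine Submodule.eq_of_le_of_finrank_eq (Submodule.span_le.2 ?_) ?_
  · rintro _ ⟨i, rfl⟩
    exact heW i
  · rw [finrank_span_eq_card (linearIndependent_of_orthogonal hpos h0 ho), hc]

/-- Expansion of a vector in an orthogonal basis. -/
theorem eq_sum_of_orthogonal {V ι : Type*} [AddCommGroup V] [Module ℚ V] [Fintype ι]
    {B : V →ₗ[ℚ] V →ₗ[ℚ] ℚ} (hpos : ∀ v, v ≠ 0 → 0 < B v v) {e : ι → V} (h0 : ∀ i, e i ≠ 0)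
    (ho : ∀ i j, i ≠ j → B (e i) (e j) = 0) {x : V}
    (hx : x ∈ Submodule.span ℚ (Set.range e)) :
    x = ∑ i, (B x (e i) / B (e i) (e i)) • e i := by
  classical
  obtain ⟨c, rfl⟩ := (Submodule.mem_span_range_iff_exists_fun ℚ).1 hx
  refine Finset.sum_congr rfl fun i _ => ?_
  congr 1
  have hi : B (e i) (e i) ≠ 0 := (hpos _ (h0 i)).ne'
  rw [map_sum, LinearMap.sum_apply, Finset.sum_eq_single i]
  · simp [hi]
  · intro j _ hji
    simp [ho j i hji]
  · simp

theorem exists_orthogonal_family {V : Type*} [AddCommGroup V] [Module ℚ V]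
    {B : V →ₗ[ℚ] V →ₗ[ℚ] ℚ} (hsymm : ∀ x y, B x y = B y x)
    (W : Submodule ℚ V) [FiniteDimensional ℚ W] :
    ∃ e : Fin (Module.finrank ℚ W) → V, (∀ i, e i ∈ W) ∧ (∀ i, e i ≠ 0) ∧
      ∀ i j, i ≠ j → B (e i) (e j) = 0 := by
  let B' : LinearMap.BilinForm ℚ W := LinearMap.BilinForm.restrict B W
  obtain ⟨v, hv⟩ := LinearMap.BilinForm.exists_orthogonal_basis (B := B') ⟨fun x y => hsymm x y⟩
  refine ⟨fun i => v i, fun i => (v i).2, fun i h => v.ne_zero i (Subtype.ext h), ?_⟩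
  exact fun i j hij => hv hij

/-- The trace identity: if `∑ₛ B(s, v)² = c B(v, v)` on `W` for vectors `s ∈ W` of norm `m`,
then `m` times their number is `c · dim W`. -/
theorem card_mul_eq_of_sum_sq {V : Type*} [AddCommGroup V] [Module ℚ V]
    {B : V →ₗ[ℚ] V →ₗ[ℚ] ℚ} (hsymm : ∀ x y, B x y = B y x) (hpos : ∀ v, v ≠ 0 → 0 < B v v)
    (W : Submodule ℚ V) [FiniteDimensional ℚ W] (A : Finset V) (hA : ∀ s ∈ A, s ∈ W) {m c : ℚ}
    (hm : ∀ s ∈ A, B s s = m) (hc : ∀ v ∈ W, ∑ s ∈ A, B s v * B s v = c * B v v) :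
    A.card * m = c * Module.finrank ℚ W := by
  obtain ⟨e, heW, h0, ho⟩ := exists_orthogonal_family hsymm W
  have hspan := span_range_eq_of_orthogonal hpos h0 ho heW (by simp)
  have hs (s) (h : s ∈ A) : m = ∑ i, B s (e i) * B s (e i) / B (e i) (e i) := by
    have h1 := congrArg (fun y => B y s)
      (eq_sum_of_orthogonal hpos h0 ho (x := s) (by rw [hspan]; exact hA s h))
    rw [← hm s h]
    refine h1.trans ?_
    rw [map_sum, LinearMap.sum_apply]
    refine Finset.sum_congr rfl fun i _ => ?_
    rw [map_smul, LinearMap.smul_apply, smul_eq_mul, hsymm (e i) s, div_mul_eq_mul_div]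
  rw [← nsmul_eq_mul, ← Finset.sum_const, Finset.sum_congr rfl hs, Finset.sum_comm]
  simp_rw [← Finset.sum_div]
  rw [Finset.sum_congr rfl fun i _ => by
    rw [hc _ (heW i), mul_div_assoc, div_self (hpos _ (h0 i)).ne', mul_one]]
  simp [mul_comm]

/-- `L` is an even unimodular positive definite lattice in `V`. -/
structure IsEvenUnimodularLattice {V : Type*} [AddCommGroup V] [Module ℚ V] (L : Submodule ℤ V)
    (B : V →ₗ[ℚ] V →ₗ[ℚ] ℚ) : Prop where
  span : Submodule.span ℚ (L : Set V) = ⊤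
  symm : ∀ x y : V, B x y = B y x
  int : ∀ x ∈ L, ∀ y ∈ L, ∃ n : ℤ, B x y = (n : ℚ)
  pos : ∀ x ∈ L, x ≠ 0 → 0 < B x x
  even : ∀ x ∈ L, ∃ n : ℤ, B x x = 2 * (n : ℚ)
  unimod : ∀ v : V, (∀ y ∈ L, ∃ n : ℤ, B v y = (n : ℚ)) → v ∈ L

/-- An orthogonal frame of vectors of the lattice. -/
structure IsFrame {V : Type*} [AddCommGroup V] [Module ℚ V] (L : Submodule ℤ V)
    (B : V →ₗ[ℚ] V →ₗ[ℚ] ℚ) {n : ℕ} (e : Fin n → V) (N : Fin n → ℕ) : Prop where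
  mem : ∀ i, e i ∈ L
  ne_zero : ∀ i, e i ≠ 0
  norm : ∀ i, B (e i) (e i) = N i
  ortho : ∀ i j, i ≠ j → B (e i) (e j) = 0

/-- The vector with given pairings with an orthogonal frame. -/
noncomputable def frameVec {V : Type*} [AddCommGroup V] [Module ℚ V] {n : ℕ} (e : Fin n → V)
    (N : Fin n → ℕ) : (Fin n → ℤ) →+ V where
  toFun a := ∑ i, ((a i : ℚ) / N i) • e i
  map_zero' := by simp
  map_add' a b := by simp [add_div, add_smul, Finset.sum_add_distrib]

theorem frameVec_apply {V : Type*} [AddCommGroup V] [Module ℚ V] {n : ℕ} (e : Fin n → V)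
    (N : Fin n → ℕ) (a : Fin n → ℤ) : frameVec e N a = ∑ i, ((a i : ℚ) / N i) • e i := rfl

namespace IsEvenUnimodularLattice

variable {V : Type*} [AddCommGroup V] [Module ℚ V] {L : Submodule ℤ V}
  {B : V →ₗ[ℚ] V →ₗ[ℚ] ℚ}

theorem exists_smul_mem (hL : IsEvenUnimodularLattice L B) (v : V) :
    ∃ n : ℕ, 0 < n ∧ (n : ℚ) • v ∈ L := by
  have hv : v ∈ Submodule.span ℚ (L : Set V) := hL.span ▸ Submodule.mem_top
  induction hv using Submodule.span_induction with
  | mem x hx => exact ⟨1, one_pos, by simpa using hx⟩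
  | zero => exact ⟨1, one_pos, by simp⟩
  | add x y _ _ hx hy =>
    obtain ⟨n, hn, hx⟩ := hx
    obtain ⟨m, hm, hy⟩ := hy
    refine ⟨n * m, by positivity, ?_⟩
    have := L.add_mem (L.smul_mem (m : ℤ) hx) (L.smul_mem (n : ℤ) hy)
    rw [← Int.cast_smul_eq_zsmul ℚ, ← Int.cast_smul_eq_zsmul ℚ, smul_smul, smul_smul] at this
    convert this using 1
    push_cast
    module
  | smul q x _ hx =>
    obtain ⟨n, hn, hx⟩ := hx
    refine ⟨n * q.den, Nat.mul_pos hn q.den_pos, ?_⟩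
    have := L.smul_mem q.num hx
    rw [← Int.cast_smul_eq_zsmul ℚ, smul_smul] at this
    convert this using 1
    rw [smul_smul]
    congr 1
    push_cast
    rw [mul_assoc, Rat.den_mul_eq_num, mul_comm]

theorem posDef (hL : IsEvenUnimodularLattice L B) (v : V) (hv : v ≠ 0) : 0 < B v v := by
  obtain ⟨n, hn, h⟩ := hL.exists_smul_mem v
  have hn' : (0 : ℚ) < n := by exact_mod_cast hn
  have := hL.pos _ h (smul_ne_zero hn'.ne' hv)
  simp only [map_smul, LinearMap.smul_apply, smul_eq_mul] at this
  exact pos_of_mul_pos_right (pos_of_mul_pos_right this hn'.le) hn'.le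

theorem isFrame_of_orthogonal (hL : IsEvenUnimodularLattice L B) {n : ℕ} {e : Fin n → V}
    (hm : ∀ i, e i ∈ L) (h0 : ∀ i, e i ≠ 0) (ho : ∀ i j, i ≠ j → B (e i) (e j) = 0) :
    ∃ N, IsFrame L B e N := by
  have (i : Fin n) : ∃ N : ℕ, B (e i) (e i) = N := by
    obtain ⟨k, hk⟩ := hL.int _ (hm i) _ (hm i)
    have h1 := hL.pos _ (hm i) (h0 i)
    rw [hk] at h1
    have h2 : 0 ≤ k := by exact_mod_cast h1.le
    lift k to ℕ using h2
    exact ⟨k, by exact_mod_cast hk⟩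
  choose N hN using this
  exact ⟨N, hm, h0, hN, ho⟩

theorem exists_isFrame (hL : IsEvenUnimodularLattice L B) [FiniteDimensional ℚ V] {n : ℕ}
    (hn : Module.finrank ℚ V = n) : ∃ (e : Fin n → V) (N : Fin n → ℕ), IsFrame L B e N := by
  have h := exists_orthogonal_family hL.symm (⊤ : Submodule ℚ V)
  rw [finrank_top, hn] at h
  obtain ⟨e, -, h0, ho⟩ := h
  choose k hk hke using fun i => hL.exists_smul_mem (e i)
  refine ⟨fun i => (k i : ℚ) • e i, hL.isFrame_of_orthogonal hke (fun i => smul_ne_zero ?_ (h0 i)) ?_⟩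
  · exact_mod_cast (hk i).ne'
  · intro i j hij
    simp [ho i j hij]

end IsEvenUnimodularLattice

namespace IsFrame

variable {V : Type*} [AddCommGroup V] [Module ℚ V] {L : Submodule ℤ V}
  {B : V →ₗ[ℚ] V →ₗ[ℚ] ℚ} {n : ℕ} {e : Fin n → V} {N : Fin n → ℕ}

theorem norm_pos (he : IsFrame L B e N) (hL : IsEvenUnimodularLattice L B) (i : Fin n) :
    0 < N i := by
  have := hL.posDef _ (he.ne_zero i)
  rw [he.norm] at this
  exact_mod_cast this

theorem span_eq_top (he : IsFrame L B e N) (hL : IsEvenUnimodularLattice L B)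
    [FiniteDimensional ℚ V] (hn : Module.finrank ℚ V = n) :
    Submodule.span ℚ (Set.range e) = ⊤ :=
  span_range_eq_of_orthogonal hL.posDef he.ne_zero he.ortho (fun _ => Submodule.mem_top)
    (by simp [hn])

theorem apply_frameVec (he : IsFrame L B e N) (hL : IsEvenUnimodularLattice L B) (a : Fin n → ℤ)
    (j : Fin n) : B (frameVec e N a) (e j) = a j := by
  have hj : (N j : ℚ) ≠ 0 := by exact_mod_cast (he.norm_pos hL j).ne'
  rw [frameVec_apply, map_sum, LinearMap.sum_apply, Finset.sum_eq_single j]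
  · simp [he.norm, hj]
  · intro i _ hij
    simp [he.ortho i j hij]
  · simp

theorem apply_frameVec_frameVec (he : IsFrame L B e N) (hL : IsEvenUnimodularLattice L B)
    (a c : Fin n → ℤ) : B (frameVec e N a) (frameVec e N c) = framePair N a c := by
  conv_lhs => rw [frameVec_apply e N c, map_sum]
  refine Finset.sum_congr rfl fun j _ => ?_
  rw [map_smul, he.apply_frameVec hL, smul_eq_mul]
  ring

theorem exists_frameVec_eq (he : IsFrame L B e N) (hL : IsEvenUnimodularLattice L B)
    [FiniteDimensional ℚ V] (hn : Module.finrank ℚ V = n) {x : V} (hx : x ∈ L) :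
    ∃ a, frameVec e N a = x := by
  choose a ha using fun i => hL.int x hx (e i) (he.mem i)
  refine ⟨a, ?_⟩
  conv_rhs => rw [eq_sum_of_orthogonal hL.posDef he.ne_zero he.ortho (x := x)
    (he.span_eq_top hL hn ▸ Submodule.mem_top)]
  simp only [ha, he.norm, frameVec_apply]

theorem isEvenUnimodularFrame (he : IsFrame L B e N) (hL : IsEvenUnimodularLattice L B)
    [FiniteDimensional ℚ V] (hn : Module.finrank ℚ V = n) :
    IsEvenUnimodularFrame N (L.toAddSubgroup.comap (frameVec e N)) where
  pos := he.norm_pos hL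
  mem_iff a := by
    simp only [← he.apply_frameVec_frameVec hL]
    refine ⟨fun ha c hc => hL.int _ ha _ hc, fun h => hL.unimod _ fun y hy => ?_⟩
    obtain ⟨c, rfl⟩ := he.exists_frameVec_eq hL hn hy
    exact h c hy
  even a ha := by
    rw [← he.apply_frameVec_frameVec hL]
    exact hL.even _ ha

theorem finite_rootSet (he : IsFrame L B e N) (hL : IsEvenUnimodularLattice L B)
    [FiniteDimensional ℚ V] (hn : Module.finrank ℚ V = n) : (rootSet L B).Finite := by
  refine (((he.isEvenUnimodularFrame hL hn).finite_framePair_self_eq 2).image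
    (frameVec e N)).subset ?_
  rintro x ⟨hx, hx2⟩
  obtain ⟨a, rfl⟩ := he.exists_frameVec_eq hL hn hx
  rw [he.apply_frameVec_frameVec hL] at hx2
  exact ⟨a, hx2, rfl⟩

theorem sum_mul_eq_zero {e : Fin 24 → V} {N : Fin 24 → ℕ} (he : IsFrame L B e N)
    (hL : IsEvenUnimodularLattice L B) [FiniteDimensional ℚ V] (hn : Module.finrank ℚ V = 24)
    {R : Finset V} (hR : (R : Set V) = rootSet L B) {i j : Fin 24} (hij : i ≠ j) :
    ∑ r ∈ R, B r (e i) * B r (e j) = 0 := by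
  classical
  have hH := he.isEvenUnimodularFrame hL hn
  have h := hH.tsum_norm_two_mul_eq_zero hij
  have hfin := (hH.finite_framePair_self_eq 2).preimage
    (Subtype.val_injective (p := (· ∈ L.toAddSubgroup.comap (frameVec e N)))).injOn
  rw [tsum_eq_sum (s := hfin.toFinset) (by
    intro a ha
    exact if_neg fun h2 => ha (hfin.mem_toFinset.2 h2))] at h
  have hcast : ((∑ r ∈ R, B r (e i) * B r (e j) : ℚ) : ℂ) = 0 := by
    rw [← h, Rat.cast_sum]
    refine (Finset.sum_bij (fun a _ => frameVec e N a.1) ?_ ?_ ?_ ?_).symm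
    · intro a ha
      rw [← Finset.mem_coe, hR]
      exact ⟨a.2, by rw [he.apply_frameVec_frameVec hL]; exact hfin.mem_toFinset.1 ha⟩
    · intro a _ b _ hab
      refine Subtype.ext (funext fun k => ?_)
      have := congrArg (fun y => B y (e k)) hab
      simp only [he.apply_frameVec hL] at this
      exact_mod_cast this
    · intro r hr
      rw [← Finset.mem_coe, hR] at hr
      obtain ⟨a, ha⟩ := he.exists_frameVec_eq hL hn hr.1
      refine ⟨⟨a, show frameVec e N a ∈ L from ha ▸ hr.1⟩, hfin.mem_toFinset.2 ?_, ha⟩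
      have := hr.2
      rwa [← ha, he.apply_frameVec_frameVec hL] at this
    · intro a ha
      have h2 : framePair N a a = 2 := hfin.mem_toFinset.1 ha
      rw [if_pos h2, he.apply_frameVec hL, he.apply_frameVec hL]
      push_cast
      rfl
  exact_mod_cast hcast

end IsFrame

namespace IsEvenUnimodularLattice

variable {V : Type*} [AddCommGroup V] [Module ℚ V] {L : Submodule ℤ V}
  {B : V →ₗ[ℚ] V →ₗ[ℚ] ℚ}

/-- The roots form a spherical design: `∑ᵣ B(r, v)²` is proportional to `B(v, v)`. -/
theorem exists_sum_sq_eq (hL : IsEvenUnimodularLattice L B) [FiniteDimensional ℚ V]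
    (hn : Module.finrank ℚ V = 24) {R : Finset V} (hR : (R : Set V) = rootSet L B) :
    ∃ c : ℚ, ∀ v, ∑ r ∈ R, B r v * B r v = c * B v v := by
  obtain ⟨e, N, he⟩ := hL.exists_isFrame hn
  have hnorm (i j : Fin 24) (hij : i ≠ j) :
      N j * ∑ r ∈ R, B r (e i) * B r (e i) = N i * ∑ r ∈ R, B r (e j) * B r (e j) := by
    have hi := he.norm i
    have hj := he.norm j
    have hNi : (N i : ℚ) ≠ 0 := by exact_mod_cast (he.norm_pos hL i).ne'
    let x := e i + e j
    let y := (N j : ℚ) • e i - (N i : ℚ) • e j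
    let e' : Fin 24 → V := Function.update (Function.update e i x) j y
    have ei : e' i = x := by simp [e', hij]
    have ej : e' j = y := by simp [e']
    have ek (k) (h1 : k ≠ i) (h2 : k ≠ j) : e' k = e k := by simp [e', h1, h2]
    have hji := he.ortho j i hij.symm
    have hij' := he.ortho i j hij
    have hxy : B x y = 0 := by
      simp [x, y, hi, hj, hji, hij']
      ring
    have hx : x ∈ L := L.add_mem (he.mem i) (he.mem j)
    have hy : y ∈ L := by
      have := L.sub_mem (L.smul_mem (N j : ℤ) (he.mem i)) (L.smul_mem (N i : ℤ) (he.mem j))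
      rwa [← Int.cast_smul_eq_zsmul ℚ, ← Int.cast_smul_eq_zsmul ℚ] at this
    have hx0 : x ≠ 0 := fun h => hNi (by
      have := congrArg (fun z => B z (e i)) h
      simpa [x, hi, hji] using this)
    have hy0 : y ≠ 0 := fun h => hNi (by
      have := congrArg (fun z => B z (e j)) h
      have hNj : (N j : ℚ) ≠ 0 := by exact_mod_cast (he.norm_pos hL j).ne'
      simpa [y, hij', hj, hNj] using this)
    have hk (k l) (h : k = i ∨ k = j) (h1 : l ≠ i) (h2 : l ≠ j) : B (e' k) (e' l) = 0 := by
      rw [ek l h1 h2]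
      rcases h with rfl | rfl
      · rw [ei]
        simp [x, he.ortho _ l h1.symm, he.ortho _ l h2.symm]
      · rw [ej]
        simp [y, he.ortho _ l h1.symm, he.ortho _ l h2.symm]
    have hcases (k) : (k = i ∨ k = j) ∨ k ≠ i ∧ k ≠ j := by tauto
    obtain ⟨N', he'⟩ := hL.isFrame_of_orthogonal (e := e') (fun k => by
      rcases hcases k with (rfl | rfl) | ⟨h1, h2⟩
      · rwa [ei]
      · rwa [ej]
      · rw [ek k h1 h2]
        exact he.mem k) (fun k => by
      rcases hcases k with (rfl | rfl) | ⟨h1, h2⟩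
      · rwa [ei]
      · rwa [ej]
      · rw [ek k h1 h2]
        exact he.ne_zero k) (fun k l hkl => by
      rcases hcases k with h | ⟨h1, h2⟩ <;> rcases hcases l with h' | ⟨h1', h2'⟩
      · rcases h with rfl | rfl <;> rcases h' with rfl | rfl
        · exact absurd rfl hkl
        · rw [ei, ej, hxy]
        · rw [ei, ej, hL.symm, hxy]
        · exact absurd rfl hkl
      · exact hk k l h h1' h2'
      · rw [hL.symm]
        exact hk l k h' h1 h2
      · rw [ek k h1 h2, ek l h1' h2', he.ortho k l hkl])
    have h := he'.sum_mul_eq_zero hL hn hR hij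
    have h0 := he.sum_mul_eq_zero hL hn hR hij
    rw [ei, ej] at h
    have hexp (r : V) : B r x * B r y = N j * (B r (e i) * B r (e i)) -
        N i * (B r (e j) * B r (e j)) + (N j - N i) * (B r (e i) * B r (e j)) := by
      simp only [x, y, map_add, map_sub, map_smul, smul_eq_mul]
      ring
    simp only [hexp, Finset.sum_add_distrib, Finset.sum_sub_distrib, ← Finset.mul_sum, h0] at h
    linarith
  let S : V →ₗ[ℚ] V →ₗ[ℚ] ℚ := ∑ r ∈ R, (B r).smulRight (B r)
  have hS (v w) : S v w = ∑ r ∈ R, B r v * B r w := by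
    simp [S, LinearMap.sum_apply]
  have hN (i) : (N i : ℚ) ≠ 0 := by exact_mod_cast (he.norm_pos hL i).ne'
  have hspan := he.span_eq_top hL hn
  have h : S = (S (e 0) (e 0) / N 0) • B := by
    refine LinearMap.ext_on_range hspan fun i => LinearMap.ext_on_range hspan fun j => ?_
    rw [LinearMap.smul_apply, LinearMap.smul_apply, smul_eq_mul]
    by_cases hij : i = j
    · subst hij
      rw [he.norm, hS, hS]
      by_cases h0 : i = 0
      · subst h0
        rw [div_mul_cancel₀ _ (hN 0)]
      · rw [div_mul_eq_mul_div, eq_div_iff (hN 0)]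
        linarith [hnorm i 0 h0]
    · rw [hS, he.sum_mul_eq_zero hL hn hR hij, he.ortho i j hij, mul_zero]
  refine ⟨S (e 0) (e 0) / N 0, fun v => ?_⟩
  rw [← hS, ← smul_eq_mul, ← LinearMap.smul_apply, ← LinearMap.smul_apply, ← h]

end IsEvenUnimodularLattice

theorem rootComponent_subset {V : Type*} [AddCommGroup V] [Module ℚ V] (L : Submodule ℤ V)
    (B : V →ₗ[ℚ] V →ₗ[ℚ] ℚ) (r : V) : rootComponent L B r ⊆ rootSet L B := fun _ h => h.1

theorem apply_eq_zero_of_notMem_rootComponent {V : Type*} [AddCommGroup V] [Module ℚ V]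
    {L : Submodule ℤ V} {B : V →ₗ[ℚ] V →ₗ[ℚ] ℚ} (hsymm : ∀ x y, B x y = B y x) {r s : V}
    (hs : s ∈ rootSet L B) (hsr : s ∉ rootComponent L B r) {v : V}
    (hv : v ∈ Submodule.span ℚ (rootComponent L B r)) : B s v = 0 := by
  have hle : Submodule.span ℚ (rootComponent L B r) ≤ LinearMap.ker (B s) := by
    refine Submodule.span_le.2 fun t ht => ?_
    by_contra h
    exact hsr ⟨hs, ht.2.tail ⟨ht.1, hs, by rwa [hsymm]⟩⟩
  exact hle hv

namespace IsEvenUnimodularLattice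

variable {V : Type*} [AddCommGroup V] [Module ℚ V] {L : Submodule ℤ V}
  {B : V →ₗ[ℚ] V →ₗ[ℚ] ℚ}

/-- The number of roots in a union `A` of components is proportional to `dim W`, for any subspace
`W` containing `A` and orthogonal to the other roots. -/
theorem exists_ncard_eq (hL : IsEvenUnimodularLattice L B) [FiniteDimensional ℚ V]
    (hn : Module.finrank ℚ V = 24) :
    ∃ c : ℚ, ∀ (A : Set V) (W : Submodule ℚ V), A ⊆ rootSet L B → A ⊆ W →
      (∀ s ∈ rootSet L B, s ∉ A → ∀ v ∈ W, B s v = 0) →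
      A.ncard * 2 = c * Module.finrank ℚ W := by
  obtain ⟨e, N, he⟩ := hL.exists_isFrame hn
  have hfin := he.finite_rootSet hL hn
  obtain ⟨c, hc⟩ := hL.exists_sum_sq_eq hn (R := hfin.toFinset) (by simp)
  refine ⟨c, fun A W hA hAW hAo => ?_⟩
  have hAfin := hfin.subset hA
  rw [Set.ncard_eq_toFinset_card A hAfin]
  refine card_mul_eq_of_sum_sq hL.symm hL.posDef W _ (fun s hs => hAW (by simpa using hs))
    (fun s hs => (hA (by simpa using hs)).2) fun v hv => ?_
  rw [← hc v]
  refine Finset.sum_subset (by simpa using hA) fun s hs hsA => ?_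
  rw [hAo s (by simpa using hs) (by simpa using hsA) v hv, mul_zero]

end IsEvenUnimodularLattice

/-- (Venkov) The root system of a Niemeier lattice `N` has rank 0 or 24, and all its
components have the same Coxeter number: `|C(r)|·dim span(C(s)) = |C(s)|·dim span(C(r))`
for all roots `r, s`. -/
theorem niemeier_root_system_rank_and_equal_coxeter_numbers
    (V : Type*) [AddCommGroup V] [Module ℚ V]
    (L : Submodule ℤ V) (hfg : L.FG)
    (hspan : Submodule.span ℚ (L : Set V) = ⊤)
    (hrank : Module.finrank ℚ V = 24)
    (B : V →ₗ[ℚ] V →ₗ[ℚ] ℚ)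
    (hsymm : ∀ x y : V, B x y = B y x)
    (hint : ∀ x ∈ L, ∀ y ∈ L, ∃ n : ℤ, B x y = (n : ℚ))
    (hpos : ∀ x ∈ L, x ≠ 0 → 0 < B x x)
    (heven : ∀ x ∈ L, ∃ n : ℤ, B x x = 2 * (n : ℚ))
    (hunimod : ∀ v : V, (∀ y ∈ L, ∃ n : ℤ, B v y = (n : ℚ)) → v ∈ L) :
    (Module.finrank ℚ (Submodule.span ℚ (rootSet L B)) = 0 ∨
      Module.finrank ℚ (Submodule.span ℚ (rootSet L B)) = 24) ∧
    (∀ r ∈ rootSet L B, ∀ s ∈ rootSet L B,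
      (rootComponent L B r).ncard *
          Module.finrank ℚ (Submodule.span ℚ (rootComponent L B s)) =
        (rootComponent L B s).ncard *
          Module.finrank ℚ (Submodule.span ℚ (rootComponent L B r))) := by
  have : FiniteDimensional ℚ V := FiniteDimensional.of_finrank_pos (by omega)
  have hL : IsEvenUnimodularLattice L B := ⟨hspan, hsymm, hint, hpos, heven, hunimod⟩
  obtain ⟨c, hc⟩ := hL.exists_ncard_eq hrank
  constructor
  · have h1 := hc (rootSet L B) (Submodule.span ℚ (rootSet L B)) subset_rfl Submodule.subset_span
      fun s hs hs' => absurd hs hs'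
    have h2 := hc (rootSet L B) ⊤ subset_rfl (fun _ _ => Submodule.mem_top)
      fun s hs hs' => absurd hs hs'
    rw [finrank_top, hrank] at h2
    by_cases h0 : c = 0
    · left
      obtain ⟨e, N, he⟩ := hL.exists_isFrame hrank
      have h3 : (rootSet L B).ncard = 0 := by simpa [h0] using h2
      rw [(Set.ncard_eq_zero (he.finite_rootSet hL hrank)).1 h3]
      simp
    · right
      exact_mod_cast mul_left_cancel₀ h0 (h1.symm.trans h2)
  · intro r _ s _
    have h (t : V) := hc (rootComponent L B t) _ (rootComponent_subset L B t)
      Submodule.subset_span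
      fun u hu hut _ hv => apply_eq_zero_of_notMem_rootComponent hsymm hu hut hv
    have hr := h r
    have hs := h s
    have : ((rootComponent L B r).ncard : ℚ) *
          Module.finrank ℚ (Submodule.span ℚ (rootComponent L B s)) =
        (rootComponent L B s).ncard *
          Module.finrank ℚ (Submodule.span ℚ (rootComponent L B r)) := by
      linear_combination
        (Module.finrank ℚ (Submodule.span ℚ (rootComponent L B s)) : ℚ) / 2 * hr -
          (Module.finrank ℚ (Submodule.span ℚ (rootComponent L B r)) : ℚ) / 2 * hs
    exact_mod_cast this
end

section
/- Let N be a Niemeier lattice whose set of roots R = {r ∈ N : B(r, r) = 2} is nonempty, and let ρ ∈ N ⊗ ℚ be the Weyl vector of N relative to a ℚ-linear functional f with f(r) ≠ 0 for all r ∈ R. Then 288·B(ρ, ρ) = |R|·(|R| + 24); equivalently, writing h = |R|/24 for the Coxeter number of N, the norm of the Weyl vector is B(ρ, ρ) = 2h(h+1). -/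
theorem Finset.sum_mul_sum_sign_of_cyclic {α : Type*} (T : Finset (α × α)) (c : α × α → α × α)
    (hc : ∀ p ∈ T, c p ∈ T) (hccc : ∀ p ∈ T, c (c (c p)) = p) (F : α × α → ℚ)
    (hF : ∀ p ∈ T, F p + F (c p) + F (c (c p)) = -1) :
    ∑ p ∈ T, F p = -(T.card : ℚ) / 3 := by
  have h1 : ∑ p ∈ T, F (c p) = ∑ p ∈ T, F p :=
    Finset.sum_nbij' c (fun p => c (c p)) hc (fun p hp => hc _ (hc _ hp)) hccc hccc
      (fun _ _ => rfl)
  have h2 : ∑ p ∈ T, F (c (c p)) = ∑ p ∈ T, F p :=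
    Finset.sum_nbij' (fun p => c (c p)) c (fun p hp => hc _ (hc _ hp)) hc hccc hccc
      (fun _ _ => rfl)
  have h3 : ∑ p ∈ T, (F p + F (c p) + F (c (c p))) = -(T.card : ℚ) := by
    rw [Finset.sum_congr rfl hF]; simp
  rw [Finset.sum_add_distrib, Finset.sum_add_distrib, h1, h2] at h3
  linarith

/-- If a finite simply laced root system `R` is a spherical 2-design in rank 24, in the sense that
`∑ r ∈ R, (r, a)² = |R| / 6` for every root `a`, then its Weyl vector satisfies
`288 (ρ, ρ) = |R| (|R| + 24)`. -/
theorem weyl_vector_norm_of_design {V : Type*} [AddCommGroup V] [Module ℚ V]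
    (B : V →ₗ[ℚ] V →ₗ[ℚ] ℚ) (hsymm : ∀ x y : V, B x y = B y x) (R : Finset V)
    (hR : ∀ r ∈ R, B r r = 2) (hneg : ∀ r ∈ R, -r ∈ R)
    (hadd : ∀ a ∈ R, ∀ b ∈ R, B a b = -1 → a + b ∈ R)
    (hval : ∀ a ∈ R, ∀ b ∈ R, a = b ∨ a = -b ∨ B a b = -1 ∨ B a b = 0 ∨ B a b = 1)
    (hdesign : ∀ a ∈ R, ∑ b ∈ R, (B a b) ^ 2 = (R.card : ℚ) / 6)
    (f : V →ₗ[ℚ] ℚ) (hf : ∀ r ∈ R, f r ≠ 0) :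
    288 * B ((2⁻¹ : ℚ) • ∑ x ∈ R with 0 < f x, x) ((2⁻¹ : ℚ) • ∑ x ∈ R with 0 < f x, x) =
      (R.card : ℚ) * (R.card + 24) := by
  classical
  set s : V → ℚ := fun r => if 0 < f r then 1 else -1 with hs
  have s_neg : ∀ r ∈ R, s (-r) = -s r := by
    intro r hr
    have := hf r hr
    simp only [hs, map_neg]
    rcases lt_or_gt_of_ne this with h | h
    · simp [h, not_lt.2 h.le]
    · simp [h, not_lt.2 h.le]
  have s_sq : ∀ r, s r * s r = 1 := by
    intro r; simp only [hs]; split_ifs <;> norm_num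
  have ne_neg : ∀ r ∈ R, r ≠ -r := by
    intro r hr h
    have h0 : B r r = - B r r := by
      rw [← map_neg, ← h]
    rw [hR r hr] at h0; norm_num at h0
  have hsum : ∑ r ∈ R, s r • r = (2 : ℚ) • ∑ x ∈ R with 0 < f x, x := by
    have h1 : ∑ r ∈ R, s r • r = ∑ x ∈ R with 0 < f x, x + ∑ x ∈ R with ¬ 0 < f x, -x := by
      rw [← Finset.sum_filter_add_sum_filter_not R (fun x => 0 < f x)]
      congr 1
      · refine Finset.sum_congr rfl fun x hx => ?_
        simp [hs, (Finset.mem_filter.1 hx).2]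
      · refine Finset.sum_congr rfl fun x hx => ?_
        simp only [hs, if_neg (Finset.mem_filter.1 hx).2, neg_smul, one_smul]
    have h2 : ∑ x ∈ R with ¬ 0 < f x, -x = ∑ x ∈ R with 0 < f x, x := by
      refine Finset.sum_nbij' (fun x => -x) (fun x => -x) ?_ ?_ (by simp) (by simp) (by simp)
      · intro x hx
        rw [Finset.mem_filter] at hx ⊢
        refine ⟨hneg x hx.1, ?_⟩
        have := lt_of_le_of_ne (not_lt.1 hx.2) (hf x hx.1)
        simpa using this
      · intro x hx
        rw [Finset.mem_filter] at hx ⊢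
        refine ⟨hneg x hx.1, ?_⟩
        simpa using hx.2.le
    rw [h1, h2, two_smul]
  have hρ : (2⁻¹ : ℚ) • ∑ x ∈ R with 0 < f x, x = (4⁻¹ : ℚ) • ∑ r ∈ R, s r • r := by
    rw [hsum, smul_smul]; norm_num
  -- the sum over all pairs, restricted to a fixed first root
  have hinner : ∀ a ∈ R, ∑ b ∈ R, s a * s b * B a b =
      4 - 2 * ∑ b ∈ R with B a b = -1, s a * s b := by
    intro a ha
    have hsplit : ∀ b ∈ R, s a * s b * B a b = (if b = a then 2 else 0) + (if b = -a then 2 else 0)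
        - (if B a b = -1 then s a * s b else 0) + (if B a b = 1 then s a * s b else 0) := by
      intro b hb
      rcases hval a ha b hb with h | h | h | h | h
      · subst h
        simp [hR a ha, ne_neg a ha, s_sq]
        norm_num
      · have hb' : b = -a := by rw [h, neg_neg]
        subst hb'
        have h2 := (ne_neg a ha).symm
        simp [hR a ha, h2, s_neg a ha, s_sq]
        norm_num
      all_goals
        have h1 : b ≠ a := by rintro rfl; rw [hR _ ha] at h; norm_num at h
        have h2 : b ≠ -a := by rintro rfl; simp [hR _ ha] at h; try norm_num at h
        simp [h, h1, h2]
        try norm_num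
    rw [Finset.sum_congr rfl hsplit]
    have hflip : ∑ b ∈ R with B a b = 1, s a * s b = - ∑ b ∈ R with B a b = -1, s a * s b := by
      rw [← Finset.sum_neg_distrib]
      refine Finset.sum_nbij' (fun x => -x) (fun x => -x) ?_ ?_ (by simp) (by simp) ?_
      · intro b hb
        rw [Finset.mem_filter] at hb ⊢
        exact ⟨hneg b hb.1, by simp [hb.2]⟩
      · intro b hb
        rw [Finset.mem_filter] at hb ⊢
        exact ⟨hneg b hb.1, by simp [hb.2]⟩
      · intro b hb
        rw [s_neg b (Finset.mem_filter.1 hb).1]; ring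
    rw [Finset.sum_add_distrib, Finset.sum_sub_distrib, Finset.sum_add_distrib,
      ← Finset.sum_filter (fun b => B a b = -1), ← Finset.sum_filter (fun b => B a b = 1), hflip]
    simp [ha, hneg a ha]
    ring
  have hcount : ∀ a ∈ R, (((R.filter fun b => B a b = -1).card : ℕ) : ℚ) =
      (R.card : ℚ) / 12 - 4 := by
    intro a ha
    have hsplit : ∀ b ∈ R, (B a b) ^ 2 = (if b = a then 4 else 0) + (if b = -a then 4 else 0)
        + (if B a b = -1 then 1 else 0) + (if B a b = 1 then 1 else 0) := by
      intro b hb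
      rcases hval a ha b hb with h | h | h | h | h
      · subst h
        simp [hR a ha, ne_neg a ha]
        norm_num
      · have hb' : b = -a := by rw [h, neg_neg]
        subst hb'
        have h2 := (ne_neg a ha).symm
        simp [hR a ha, h2]
        norm_num
      all_goals
        have h1 : b ≠ a := by rintro rfl; rw [hR _ ha] at h; norm_num at h
        have h2 : b ≠ -a := by rintro rfl; simp [hR _ ha] at h; try norm_num at h
        simp [h, h1, h2]
        try norm_num
    have hflip : (R.filter fun b => B a b = 1).card = (R.filter fun b => B a b = -1).card := by
      refine Finset.card_nbij' (fun x => -x) (fun x => -x) ?_ ?_ (by intro; simp) (by intro; simp)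
      · intro b hb
        simp only [Finset.coe_filter, Set.mem_ofPred_eq] at hb ⊢
        exact ⟨hneg b hb.1, by simp [hb.2]⟩
      · intro b hb
        simp only [Finset.coe_filter, Set.mem_ofPred_eq] at hb ⊢
        exact ⟨hneg b hb.1, by simp [hb.2]⟩
    have h := hdesign a ha
    rw [Finset.sum_congr rfl hsplit, Finset.sum_add_distrib, Finset.sum_add_distrib,
      Finset.sum_add_distrib, Finset.sum_boole, Finset.sum_boole, hflip] at h
    simp [ha, hneg a ha] at h
    linarith
  set T : Finset (V × V) := (R ×ˢ R).filter fun p => B p.1 p.2 = -1 with hT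
  have hTsum : ∀ F : V → V → ℚ,
      ∑ p ∈ T, F p.1 p.2 = ∑ a ∈ R, ∑ b ∈ R with B a b = -1, F a b := by
    intro F
    rw [hT, Finset.sum_filter, Finset.sum_product]
    refine Finset.sum_congr rfl fun a _ => ?_
    rw [Finset.sum_filter]
  have hTcard : (T.card : ℚ) = R.card * ((R.card : ℚ) / 12 - 4) := by
    have h := hTsum (fun _ _ => 1)
    simp only [Finset.sum_const, nsmul_eq_mul, mul_one] at h
    rw [h, Finset.sum_congr rfl hcount, Finset.sum_const, nsmul_eq_mul]
  have hTs : ∑ p ∈ T, s p.1 * s p.2 = -(T.card : ℚ) / 3 := by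
    have memT : ∀ p, p ∈ T ↔ (p.1 ∈ R ∧ p.2 ∈ R) ∧ B p.1 p.2 = -1 := by
      intro p; rw [hT, Finset.mem_filter, Finset.mem_product]
    refine Finset.sum_mul_sum_sign_of_cyclic T (fun p => (p.2, -(p.1 + p.2))) ?_ ?_ _ ?_
    · intro p hp
      rw [memT] at hp ⊢
      refine ⟨⟨hp.1.2, hneg _ (hadd _ hp.1.1 _ hp.1.2 hp.2)⟩, ?_⟩
      simp only [map_neg, map_add, hR _ hp.1.2]
      rw [hsymm, hp.2]; norm_num
    · intro p hp
      ext <;> simp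
    · intro p hp
      rw [memT] at hp
      have h3 := hf _ (hadd _ hp.1.1 _ hp.1.2 hp.2)
      have h1 := hf _ hp.1.1
      have h2 := hf _ hp.1.2
      simp only [hs, map_neg, map_add] at h3 ⊢
      have e : -(f p.2 + -(f p.1 + f p.2)) = f p.1 := by ring
      rw [e]
      rcases lt_or_gt_of_ne h1 with h1 | h1 <;> rcases lt_or_gt_of_ne h2 with h2 | h2 <;>
      rcases lt_or_gt_of_ne h3 with h3 | h3 <;>
      split_ifs <;> first | (exfalso; linarith) | norm_num
  have hmain : B (∑ r ∈ R, s r • r) (∑ r ∈ R, s r • r) = 4 * R.card + 2 * T.card / 3 := by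
    have : B (∑ r ∈ R, s r • r) (∑ r ∈ R, s r • r) = ∑ a ∈ R, ∑ b ∈ R, s a * s b * B a b := by
      simp only [map_sum, LinearMap.sum_apply, map_smul, LinearMap.smul_apply, smul_eq_mul]
      rw [Finset.sum_comm]
      refine Finset.sum_congr rfl fun a _ => ?_
      rw [Finset.mul_sum]
      refine Finset.sum_congr rfl fun b _ => ?_
      rw [hsymm b a]
      ring
    rw [this, Finset.sum_congr rfl hinner, Finset.sum_sub_distrib, ← Finset.mul_sum,
      ← hTsum (fun a b => s a * s b), hTs]
    simp
    ring
  rw [hρ]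
  simp only [map_smul, LinearMap.smul_apply, smul_eq_mul]
  rw [hmain, hTcard]
  ring

theorem hasSum_prod_pi : ∀ {n : ℕ} {f : Fin n → ℤ → ℂ}, (∀ k, Summable (f k)) →
    HasSum (fun x : Fin n → ℤ => ∏ k, f k (x k)) (∏ k, ∑' m, f k m)
  | 0, f, _ => by simp [hasSum_unique]
  | n + 1, f, h => by
    have ih := hasSum_prod_pi fun k : Fin n => h k.succ
    have h0 := (h 0).hasSum
    have hs := summable_mul_of_summable_norm (h 0).norm ih.summable.norm
    have := h0.mul ih hs
    rw [Fin.prod_univ_succ, ← (Fin.consEquiv fun _ => ℤ).hasSum_iff]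
    simpa [Function.comp_def, Fin.consEquiv, Fin.prod_univ_succ] using this

open Complex Real in
theorem tsum_cexp_quadratic_transform (d : ℤ) (hd : 0 < d) (c : ℤ) (t : ℝ) (ht : 0 < t) (τ : ℂ)
    (hτ : 0 < τ.im) :
    Summable (fun y : ℤ => cexp (-(2 * π * I * (c * y / d))) * cexp (π * I * τ * (t * y ^ 2 / d))) ∧
    Summable (fun m : ℤ => cexp (π * I * (-1 / τ) * (t⁻¹ * ((d * m + c : ℤ) : ℂ) ^ 2 / d))) ∧
    ∑' y : ℤ, cexp (-(2 * π * I * (c * y / d))) * cexp (π * I * τ * (t * y ^ 2 / d)) =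
      1 / (-I * ((t / d : ℝ) * τ)) ^ (1 / 2 : ℂ) *
        ∑' m : ℤ, cexp (π * I * (-1 / τ) * (t⁻¹ * ((d * m + c : ℤ) : ℂ) ^ 2 / d)) := by
  have hd' : (0 : ℝ) < d := by exact_mod_cast hd
  have hdc : (d : ℂ) ≠ 0 := by exact_mod_cast hd.ne'
  have htc : (t : ℂ) ≠ 0 := by exact_mod_cast ht.ne'
  have hτ0 : τ ≠ 0 := by rintro rfl; simp at hτ
  set σ : ℂ := (t / d : ℝ) * τ with hσ
  have him : 0 < σ.im := by
    rw [hσ, Complex.im_ofReal_mul]; positivity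
  have him' : 0 < (-1 / σ).im := by
    rw [neg_div, neg_im, one_div, inv_im, neg_div, neg_neg]
    exact div_pos him (normSq_pos.2 (by rintro h; simp [h] at him))
  have e1 : ∀ y : ℤ, cexp (-(2 * π * I * (c * y / d))) * cexp (π * I * τ * (t * y ^ 2 / d)) =
      jacobiTheta₂_term y (-c / d) σ := by
    intro y
    rw [jacobiTheta₂_term, ← Complex.exp_add, hσ]
    congr 1
    push_cast
    field_simp
  have e2 : ∀ m : ℤ, cexp (π * I * (-1 / τ) * (t⁻¹ * ((d * m + c : ℤ) : ℂ) ^ 2 / d)) =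
      cexp (-π * I * (-c / d) ^ 2 / σ) * jacobiTheta₂_term m (-c / d / σ) (-1 / σ) := by
    intro m
    rw [jacobiTheta₂_term, ← Complex.exp_add, hσ]
    congr 1
    push_cast
    field_simp
    ring
  simp only [e1, e2]
  refine ⟨(hasSum_jacobiTheta₂_term _ him).summable,
    (hasSum_jacobiTheta₂_term _ him').summable.mul_left _, ?_⟩
  rw [tsum_mul_left, (hasSum_jacobiTheta₂_term _ him).tsum_eq,
    (hasSum_jacobiTheta₂_term _ him').tsum_eq, jacobiTheta₂_functional_equation, mul_assoc]

open Complex Real in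
theorem neg_I_mul_cpow_half (a : ℝ) (ha : 0 < a) (τ : ℂ) :
    (-I * (a * τ)) ^ (1 / 2 : ℂ) = (√a : ℝ) * (-I * τ) ^ (1 / 2 : ℂ) := by
  rcases eq_or_ne τ 0 with rfl | hτ
  · simp
  have h : -I * τ ≠ 0 := by simp [hτ]
  have ha' : (a : ℂ) ≠ 0 := by exact_mod_cast ha.ne'
  rw [mul_left_comm, cpow_def_of_ne_zero (mul_ne_zero ha' h), cpow_def_of_ne_zero h,
    Complex.log_ofReal_mul ha h, add_mul, Complex.exp_add]
  congr 1
  rw [Real.sqrt_eq_rpow, Real.rpow_def_of_pos ha]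
  push_cast
  rfl


/-- The form `∑ k, x k * y k / d k` on `ℤ ^ n`. -/
noncomputable def diagForm {n : ℕ} (d : Fin n → ℤ) (x y : Fin n → ℤ) : ℝ :=
  ∑ k, (x k : ℝ) * y k / d k

open Classical in
/-- Representatives of `Λ` modulo the sublattice `∏ k, d k ℤ`. -/
noncomputable def latticeReps {n : ℕ} (d : Fin n → ℤ) (Λ : AddSubgroup (Fin n → ℤ)) :
    Finset (Fin n → ℤ) :=
  (Fintype.piFinset fun k => Finset.Ico 0 (d k)).filter (· ∈ Λ)

section Lattice

variable {n : ℕ} {d : Fin n → ℤ} {Λ : AddSubgroup (Fin n → ℤ)}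

theorem mem_latticeReps {c : Fin n → ℤ} :
    c ∈ latticeReps d Λ ↔ (∀ k, 0 ≤ c k ∧ c k < d k) ∧ c ∈ Λ := by
  simp [latticeReps]

theorem mul_mem_of_single_mem (hmem : ∀ k, Pi.single k (d k) ∈ Λ) (m : Fin n → ℤ) :
    (fun k => d k * m k) ∈ Λ := by
  have : (fun k => d k * m k) = ∑ k, m k • (Pi.single k (d k) : Fin n → ℤ) := by
    ext j
    simp [Finset.sum_apply, Pi.single_apply, mul_comm]
  rw [this]
  exact sum_mem fun k _ => zsmul_mem (hmem k) _

theorem emod_mem_latticeReps (hd : ∀ k, 0 < d k) (hmem : ∀ k, Pi.single k (d k) ∈ Λ)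
    {x : Fin n → ℤ} (hx : x ∈ Λ) : (fun k => x k % d k) ∈ latticeReps d Λ := by
  refine mem_latticeReps.2 ⟨fun k => ⟨Int.emod_nonneg _ (hd k).ne', Int.emod_lt_of_pos _ (hd k)⟩, ?_⟩
  have h := sub_mem hx (mul_mem_of_single_mem hmem fun k => x k / d k)
  convert h using 1
  ext k
  simp [Int.emod_def]

open Complex in
theorem sum_latticeReps_cexp (hd : ∀ k, 0 < d k) (hmem : ∀ k, Pi.single k (d k) ∈ Λ)
    (hint : ∀ x ∈ Λ, ∀ y ∈ Λ, ∃ m : ℤ, diagForm d x y = m)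
    (hdual : ∀ y, (∀ x ∈ Λ, ∃ m : ℤ, diagForm d x y = m) → y ∈ Λ) (y : Fin n → ℤ) :
    ∑ c ∈ latticeReps d Λ, ∏ k, cexp (-(2 * Real.pi * I * (c k * y k / d k))) =
      (Λ : Set (Fin n → ℤ)).indicator (fun _ => ((latticeReps d Λ).card : ℂ)) y := by
  set χ : (Fin n → ℤ) → ℂ := fun c => ∏ k, cexp (-(2 * Real.pi * I * (c k * y k / d k))) with hχ
  have hd0 : ∀ k, (d k : ℂ) ≠ 0 := fun k => by exact_mod_cast (hd k).ne'
  have χ_eq : ∀ c, χ c = cexp (2 * Real.pi * I * (-diagForm d c y : ℝ)) := by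
    intro c
    rw [hχ]
    simp only
    rw [← Complex.exp_sum, Finset.sum_neg_distrib, ← Finset.mul_sum, diagForm]
    push_cast
    rw [mul_neg]
  have χ_one : ∀ c, χ c = 1 ↔ ∃ m : ℤ, diagForm d c y = m := by
    intro c
    rw [χ_eq, Complex.exp_eq_one_iff]
    have h2 : (2 * Real.pi * I : ℂ) ≠ 0 := by simp [Real.pi_ne_zero]
    constructor
    · rintro ⟨m, hm⟩
      rw [mul_comm _ (2 * Real.pi * I : ℂ)] at hm
      have := mul_left_cancel₀ h2 hm
      refine ⟨-m, ?_⟩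
      have h3 : -diagForm d c y = m := by exact_mod_cast this
      push_cast
      linarith
    · rintro ⟨m, hm⟩
      refine ⟨-m, ?_⟩
      rw [hm]; push_cast; ring
  have χ_add : ∀ a b : Fin n → ℤ, χ (a + b) = χ a * χ b := by
    intro a b
    simp only [hχ]
    rw [← Finset.prod_mul_distrib]
    refine Finset.prod_congr rfl fun k _ => ?_
    rw [← Complex.exp_add]
    congr 1
    simp only [Pi.add_apply]
    push_cast
    ring
  have χ_emod : ∀ a : Fin n → ℤ, χ (fun k => a k % d k) = χ a := by
    intro a
    have h1 : χ (fun k => d k * (a k / d k)) = 1 := by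
      rw [χ_one]
      refine ⟨∑ k, a k / d k * y k, ?_⟩
      rw [diagForm]
      push_cast
      refine Finset.sum_congr rfl fun k _ => ?_
      have : (d k : ℝ) ≠ 0 := by exact_mod_cast (hd k).ne'
      field_simp
    have h2 : (fun k => a k % d k) + (fun k => d k * (a k / d k)) = a := by
      ext k
      exact Int.emod_add_mul_ediv _ _
    conv_rhs => rw [← h2, χ_add, h1, mul_one]
  by_cases hy : y ∈ Λ
  · rw [Set.indicator_of_mem (by exact hy)]
    rw [Finset.sum_congr rfl fun c hc => (χ_one c).2 (hint c (mem_latticeReps.1 hc).2 y hy)]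
    simp
  · rw [Set.indicator_of_notMem (by exact hy)]
    obtain ⟨x, hx, hxy⟩ : ∃ x ∈ Λ, ¬ ∃ m : ℤ, diagForm d x y = m := by
      by_contra! h
      exact hy (hdual y h)
    have hx1 : χ x ≠ 1 := fun h => hxy ((χ_one x).1 h)
    have hshift : ∑ c ∈ latticeReps d Λ, χ c = ∑ c ∈ latticeReps d Λ, χ x * χ c := by
      symm
      refine Finset.sum_nbij' (fun c k => (c k + x k) % d k) (fun c k => (c k - x k) % d k)
        ?_ ?_ ?_ ?_ ?_
      · intro c hc
        exact emod_mem_latticeReps hd hmem (add_mem (mem_latticeReps.1 hc).2 hx)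
      · intro c hc
        exact emod_mem_latticeReps hd hmem (sub_mem (mem_latticeReps.1 hc).2 hx)
      · intro c hc
        ext k
        have := (mem_latticeReps.1 hc).1 k
        simp only [Int.emod_sub_emod, add_sub_cancel_right]
        exact Int.emod_eq_of_lt this.1 this.2
      · intro c hc
        ext k
        have := (mem_latticeReps.1 hc).1 k
        simp only [Int.emod_add_emod, sub_add_cancel]
        exact Int.emod_eq_of_lt this.1 this.2
      · intro c hc
        rw [mul_comm, ← χ_add]
        exact (χ_emod (c + x)).symm
    rw [← Finset.mul_sum] at hshift
    have : (χ x - 1) * ∑ c ∈ latticeReps d Λ, χ c = 0 := by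
      rw [sub_mul, one_mul, ← hshift, sub_self]
    exact (mul_eq_zero.1 this).resolve_left (sub_ne_zero.2 hx1)

end Lattice

/-- The quadratic form `∑ k, t k * x k ^ 2 / d k` on `ℤ ^ n`. -/
noncomputable def weightedNorm {n : ℕ} (d : Fin n → ℤ) (t : Fin n → ℝ) (x : Fin n → ℤ) : ℝ :=
  ∑ k, t k * (x k : ℝ) ^ 2 / d k

section Lattice

variable {n : ℕ} {d : Fin n → ℤ} {Λ : AddSubgroup (Fin n → ℤ)}

theorem hasSum_indicator_of_latticeReps (hd : ∀ k, 0 < d k)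
    (hmem : ∀ k, Pi.single k (d k) ∈ Λ) {g : (Fin n → ℤ) → ℂ} {a : (Fin n → ℤ) → ℂ}
    (h : ∀ c, HasSum (fun m : Fin n → ℤ => g fun k => d k * m k + c k) (a c)) :
    HasSum ((Λ : Set (Fin n → ℤ)).indicator g) (∑ c ∈ latticeReps d Λ, a c) := by
  set φ : (Fin n → ℤ) → (Fin n → ℤ) → (Fin n → ℤ) := fun c m k => d k * m k + c k with hφ
  have hinj : ∀ c, Function.Injective (φ c) := by
    intro c m m' hm
    ext k
    have := congrFun hm k
    simp only [hφ, add_left_inj] at this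
    exact mul_left_cancel₀ (hd k).ne' this
  have h1 : ∀ c, HasSum ((Set.range (φ c)).indicator g) (a c) := by
    intro c
    rw [← (hinj c).hasSum_iff]
    · convert h c using 2 with m
      exact Set.indicator_of_mem (Set.mem_range_self m) _
    · intro x hx
      exact Set.indicator_of_notMem hx _
  convert (hasSum_sum fun c _ => h1 c : HasSum _ (∑ c ∈ latticeReps d Λ, a c)) using 1
  ext x
  have hrange : ∀ c ∈ latticeReps d Λ, x ∈ Set.range (φ c) → (fun k => x k % d k) = c := by
    rintro c hc ⟨m, rfl⟩
    ext k
    have := (mem_latticeReps.1 hc).1 k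
    simp only [hφ, Int.mul_add_emod_self_left]
    exact Int.emod_eq_of_lt this.1 this.2
  by_cases hx : x ∈ Λ
  · rw [Set.indicator_of_mem (by exact hx),
      Finset.sum_eq_single_of_mem _ (emod_mem_latticeReps hd hmem hx), Set.indicator_of_mem]
    · exact ⟨fun k => x k / d k, funext fun k => Int.mul_ediv_add_emod _ _⟩
    · exact fun c hc hne => Set.indicator_of_notMem (fun hx' => hne (hrange c hc hx').symm) _
  · rw [Set.indicator_of_notMem (by exact hx)]
    refine (Finset.sum_eq_zero fun c hc => Set.indicator_of_notMem ?_ _).symm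
    rintro ⟨m, rfl⟩
    exact hx (add_mem (mul_mem_of_single_mem hmem m) (mem_latticeReps.1 hc).2)

open Complex in
theorem theta_transform (hd : ∀ k, 0 < d k) (hmem : ∀ k, Pi.single k (d k) ∈ Λ)
    (hint : ∀ x ∈ Λ, ∀ y ∈ Λ, ∃ m : ℤ, diagForm d x y = m)
    (hdual : ∀ y, (∀ x ∈ Λ, ∃ m : ℤ, diagForm d x y = m) → y ∈ Λ)
    (t : Fin n → ℝ) (ht : ∀ k, 0 < t k) {τ : ℂ} (hτ : 0 < τ.im) :
    ((latticeReps d Λ).card : ℂ) * ∑' x : Fin n → ℤ, (Λ : Set (Fin n → ℤ)).indicator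
        (fun x => cexp (Real.pi * I * τ * weightedNorm d t x)) x =
      (∏ k, 1 / (-I * ((t k / d k : ℝ) * τ)) ^ (1 / 2 : ℂ)) *
        ∑' x : Fin n → ℤ, (Λ : Set (Fin n → ℤ)).indicator
          (fun x => cexp (Real.pi * I * (-1 / τ) * weightedNorm d (fun k => (t k)⁻¹) x)) x := by
  have h := fun c k => tsum_cexp_quadratic_transform (d k) (hd k) c (t k) (ht k) τ hτ
  have hexp : ∀ (σ : ℂ) (s : Fin n → ℝ) (x : Fin n → ℤ),
      cexp (Real.pi * I * σ * weightedNorm d s x) =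
        ∏ k, cexp (Real.pi * I * σ * (s k * x k ^ 2 / d k)) := by
    intro σ s x
    rw [← Complex.exp_sum, ← Finset.mul_sum, weightedNorm]
    push_cast
    rfl
  have hB := hasSum_indicator_of_latticeReps hd hmem
    (g := fun x => cexp (Real.pi * I * (-1 / τ) * weightedNorm d (fun k => (t k)⁻¹) x))
    (a := fun c => ∏ k, ∑' m : ℤ, cexp (Real.pi * I * (-1 / τ) *
      ((t k : ℂ)⁻¹ * ((d k * m + c k : ℤ) : ℂ) ^ 2 / d k)))
    (fun c => by
      simp only [hexp]
      convert hasSum_prod_pi (fun k => (h (c k) k).2.1) using 1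
      simp)
  have hA := hasSum_sum (s := latticeReps d Λ) fun c _ => hasSum_prod_pi (fun k => (h (c k) k).1)
  have hA' : ∀ y : Fin n → ℤ, ∑ c ∈ latticeReps d Λ, ∏ k,
      (cexp (-(2 * Real.pi * I * (c k * y k / d k))) *
        cexp (Real.pi * I * τ * (t k * y k ^ 2 / d k))) =
      (latticeReps d Λ).card * (Λ : Set (Fin n → ℤ)).indicator
        (fun x => cexp (Real.pi * I * τ * weightedNorm d t x)) y := by
    intro y
    simp only [Finset.prod_mul_distrib]
    rw [← Finset.sum_mul, sum_latticeReps_cexp hd hmem hint hdual, ← hexp]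
    by_cases hy : y ∈ (Λ : Set (Fin n → ℤ)) <;> simp [hy]
  simp only [hA'] at hA
  rw [hB.tsum_eq, ← tsum_mul_left, hA.tsum_eq, Finset.mul_sum]
  refine Finset.sum_congr rfl fun c _ => ?_
  rw [← Finset.prod_mul_distrib]
  exact Finset.prod_congr rfl fun k _ => by simpa using (h (c k) k).2.2

end Lattice

section Lattice

variable {n : ℕ} {d : Fin n → ℤ} {Λ : AddSubgroup (Fin n → ℤ)}

theorem weightedNorm_one_nonneg (hd : ∀ k, 0 < d k) (x : Fin n → ℤ) : 0 ≤ weightedNorm d 1 x :=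
  Finset.sum_nonneg fun k _ => by
    have : (0 : ℝ) < d k := by exact_mod_cast hd k
    simp only [Pi.one_apply]
    positivity

theorem weightedNorm_mono (hd : ∀ k, 0 < d k) {s t : Fin n → ℝ} (h : ∀ k, s k ≤ t k)
    (x : Fin n → ℤ) : weightedNorm d s x ≤ weightedNorm d t x :=
  Finset.sum_le_sum fun k _ => by
    have : (0 : ℝ) < d k := by exact_mod_cast hd k
    have := h k
    gcongr

theorem weightedNorm_const (a : ℝ) (x : Fin n → ℤ) :
    weightedNorm d (fun _ => a) x = a * weightedNorm d 1 x := by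
  simp only [weightedNorm, Finset.mul_sum, Pi.one_apply]
  exact Finset.sum_congr rfl fun k _ => by ring

theorem abs_weightedNorm_le (hd : ∀ k, 0 < d k) {s : Fin n → ℝ} {M : ℝ} (h : ∀ k, |s k| ≤ M)
    (x : Fin n → ℤ) : |weightedNorm d s x| ≤ M * weightedNorm d 1 x := by
  rw [abs_le, ← neg_mul, ← weightedNorm_const, ← weightedNorm_const]
  exact ⟨weightedNorm_mono hd (fun k => (abs_le.1 (h k)).1) x,
    weightedNorm_mono hd (fun k => (abs_le.1 (h k)).2) x⟩

theorem summable_exp_neg_weightedNorm (hd : ∀ k, 0 < d k) {b : ℝ} (hb : 0 < b) :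
    Summable fun x : Fin n → ℤ => Real.exp (-b * weightedNorm d 1 x) := by
  have h := (hasSum_prod_pi fun k => (tsum_cexp_quadratic_transform (d k) (hd k) 0 1 one_pos
    (b / Real.pi * Complex.I) (by simp [← Complex.ofReal_div]; positivity)).1).summable.norm
  convert h using 2 with x
  rw [norm_prod, weightedNorm, Finset.mul_sum, Real.exp_sum]
  refine Finset.prod_congr rfl fun k _ => ?_
  rw [← Complex.exp_add, Complex.norm_exp]
  congr 1
  have : (Real.pi : ℂ) ≠ 0 := by simp [Real.pi_ne_zero]
  rw [show (-(2 * Real.pi * Complex.I * ((0 : ℤ) * x k / d k)) + Real.pi * Complex.I *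
      (b / Real.pi * Complex.I) * ((1 : ℝ) * x k ^ 2 / d k) : ℂ) =
      ((-b * (1 * (x k) ^ 2 / d k) : ℝ) : ℂ) by
    push_cast
    field_simp
    ring_nf
    rw [Complex.I_sq]
    ring]
  rw [Complex.ofReal_re]
  simp

theorem mul_exp_neg_le {b : ℝ} (hb : 0 < b) (q : ℝ) :
    q * Real.exp (-b * q) ≤ 2 / b * Real.exp (-(b / 2) * q) := by
  have h1 : b / 2 * q ≤ Real.exp (b / 2 * q) := by
    linarith [Real.add_one_le_exp (b / 2 * q)]
  have h2 : Real.exp (-b * q) = Real.exp (-(b / 2) * q) * Real.exp (-(b / 2 * q)) := by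
    rw [← Real.exp_add]; ring_nf
  have h3 : b / 2 * q * Real.exp (-(b / 2 * q)) ≤ 1 := by
    rw [Real.exp_neg, ← div_eq_mul_inv]
    exact (div_le_one (Real.exp_pos _)).2 h1
  rw [h2]
  have h4 := (Real.exp_pos (-(b / 2) * q)).le
  have h5 := mul_le_mul_of_nonneg_left h3 h4
  have : q * (Real.exp (-(b / 2) * q) * Real.exp (-(b / 2 * q))) = 2 / b *
    (Real.exp (-(b / 2) * q) * (b / 2 * q * Real.exp (-(b / 2 * q)))) := by
    field_simp
  rw [this]
  gcongr
  simpa using h5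

theorem summable_mul_exp_neg_weightedNorm (hd : ∀ k, 0 < d k) {b : ℝ} (hb : 0 < b) :
    Summable fun x : Fin n → ℤ => weightedNorm d 1 x * Real.exp (-b * weightedNorm d 1 x) :=
  Summable.of_nonneg_of_le
    (fun x => mul_nonneg (weightedNorm_one_nonneg hd x) (Real.exp_pos _).le)
    (fun _ => mul_exp_neg_le hb _)
    ((summable_exp_neg_weightedNorm hd (half_pos hb)).mul_left _)

open Complex

theorem norm_cexp_weightedNorm (τ : ℂ) (t : Fin n → ℝ) (x : Fin n → ℤ) :
    ‖cexp (Real.pi * I * τ * weightedNorm d t x)‖ =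
      Real.exp (-(Real.pi * τ.im) * weightedNorm d t x) := by
  rw [Complex.norm_exp]
  congr 1
  simp [Complex.mul_re, Complex.mul_im]

/-- The theta series of `Λ` weighted by the quadratic polynomial `∑ k, u k * x k ^ 2 / d k`. -/
noncomputable def weightedTheta (d : Fin n → ℤ) (Λ : AddSubgroup (Fin n → ℤ)) (u : Fin n → ℝ)
    (τ : ℂ) : ℂ :=
  ∑' x : Fin n → ℤ, (Λ : Set (Fin n → ℤ)).indicator
    (fun x => weightedNorm d u x * cexp (Real.pi * I * τ * weightedNorm d 1 x)) x

theorem hasDerivAt_theta_deformation (hd : ∀ k, 0 < d k) (u : Fin n → ℝ) {τ : ℂ} (hτ : 0 < τ.im) :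
    HasDerivAt (fun s : ℝ => ∑' x : Fin n → ℤ, (Λ : Set (Fin n → ℤ)).indicator
        (fun x => cexp (Real.pi * I * τ * weightedNorm d (fun k => Real.exp (s * u k)) x)) x)
      (Real.pi * I * τ * weightedTheta d Λ u τ) 0 := by
  obtain ⟨M, hM0, hM⟩ : ∃ M : ℝ, 0 ≤ M ∧ ∀ k, |u k| ≤ M :=
    ⟨∑ k, |u k|, Finset.sum_nonneg fun _ _ => abs_nonneg _,
      fun k => Finset.single_le_sum (f := fun k => |u k|) (fun _ _ => abs_nonneg _)
        (Finset.mem_univ k)⟩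
  have hπ := Real.pi_pos
  set b := Real.pi * τ.im * Real.exp (-M) with hb
  have hb0 : 0 < b := by positivity
  have hlow : ∀ s ∈ Set.Ioo (-1 : ℝ) 1, ∀ k, |s * u k| ≤ M := by
    intro s hs k
    rw [abs_mul]
    have h1 : |s| ≤ 1 := abs_le.2 ⟨hs.1.le, hs.2.le⟩
    calc |s| * |u k| ≤ 1 * M := mul_le_mul h1 (hM k) (abs_nonneg _) zero_le_one
      _ = M := one_mul M
  have hbound : Summable fun x : Fin n → ℤ => (Real.pi * ‖τ‖ * (M * Real.exp M)) *
      (weightedNorm d 1 x * Real.exp (-b * weightedNorm d 1 x)) :=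
    (summable_mul_exp_neg_weightedNorm hd hb0).mul_left _
  have hderiv : ∀ (x : Fin n → ℤ) (s : ℝ), HasDerivAt
      (fun s : ℝ => cexp (Real.pi * I * τ * weightedNorm d (fun k => Real.exp (s * u k)) x))
      (cexp (Real.pi * I * τ * weightedNorm d (fun k => Real.exp (s * u k)) x) *
        (Real.pi * I * τ * weightedNorm d (fun k => u k * Real.exp (s * u k)) x)) s := by
    intro x s
    have h1 : HasDerivAt (fun s : ℝ => weightedNorm d (fun k => Real.exp (s * u k)) x)
        (weightedNorm d (fun k => u k * Real.exp (s * u k)) x) s := by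
      unfold weightedNorm
      refine HasDerivAt.fun_sum fun k _ => ?_
      have := (((hasDerivAt_id s).mul_const (u k)).exp.mul_const ((x k : ℝ) ^ 2)).div_const (d k : ℝ)
      refine this.congr_deriv ?_
      simp only [id]
      ring
    exact (h1.ofReal_comp.const_mul (Real.pi * I * τ)).cexp
  have key := hasDerivAt_tsum_of_isPreconnected (𝕜 := ℝ) hbound (t := Set.Ioo (-1 : ℝ) 1)
    (g := fun x s => (Λ : Set (Fin n → ℤ)).indicator (fun x =>
      cexp (Real.pi * I * τ * weightedNorm d (fun k => Real.exp (s * u k)) x)) x)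
    (g' := fun x s => (Λ : Set (Fin n → ℤ)).indicator (fun x =>
      cexp (Real.pi * I * τ * weightedNorm d (fun k => Real.exp (s * u k)) x) *
        (Real.pi * I * τ * weightedNorm d (fun k => u k * Real.exp (s * u k)) x)) x)
    (y₀ := 0) (y := 0) isOpen_Ioo isPreconnected_Ioo ?_ ?_ (by simp) ?_ (by simp)
  · refine key.congr_deriv ?_
    rw [weightedTheta, ← tsum_mul_left]
    refine tsum_congr fun x => ?_
    by_cases hx : x ∈ (Λ : Set (Fin n → ℤ))
    · simp only [hx, Set.indicator_of_mem, zero_mul, Real.exp_zero, mul_one]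
      rw [show (fun _ => 1 : Fin n → ℝ) = 1 from rfl]
      ring
    · simp [hx]
  · intro x s _
    by_cases hx : x ∈ (Λ : Set (Fin n → ℤ))
    · simpa only [hx, Set.indicator_of_mem] using hderiv x s
    · simpa only [hx, Set.indicator_of_notMem, not_false_eq_true] using hasDerivAt_const s (0 : ℂ)
  · intro x s hs
    refine (norm_indicator_le_norm_self _ _).trans ?_
    rw [norm_mul, norm_cexp_weightedNorm, norm_mul, norm_mul, norm_mul, norm_I, Complex.norm_real,
      Complex.norm_real, Real.norm_of_nonneg hπ.le, mul_one, Real.norm_eq_abs]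
    have hq := weightedNorm_one_nonneg hd x
    have e1 : |weightedNorm d (fun k => u k * Real.exp (s * u k)) x| ≤
        M * Real.exp M * weightedNorm d 1 x := by
      refine abs_weightedNorm_le hd (fun k => ?_) x
      rw [abs_mul, Real.abs_exp]
      have := hM k
      have h3 := (abs_le.1 (hlow s hs k)).2
      gcongr
    have e2 : Real.exp (-(Real.pi * τ.im) * weightedNorm d (fun k => Real.exp (s * u k)) x) ≤
        Real.exp (-b * weightedNorm d 1 x) := by
      rw [Real.exp_le_exp, hb, neg_mul, neg_mul, neg_le_neg_iff, mul_assoc (Real.pi * τ.im),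
        ← weightedNorm_const]
      refine mul_le_mul_of_nonneg_left (weightedNorm_mono hd (fun k => ?_) x) (by positivity)
      rw [Real.exp_le_exp]
      exact (abs_le.1 (hlow s hs k)).1
    calc _ ≤ Real.exp (-b * weightedNorm d 1 x) * (Real.pi * ‖τ‖ *
          (M * Real.exp M * weightedNorm d 1 x)) := by gcongr
      _ = _ := by ring
  · have hs := summable_exp_neg_weightedNorm hd (b := Real.pi * τ.im) (by positivity)
    refine hs.of_norm_bounded fun x => ?_
    refine (norm_indicator_le_norm_self _ _).trans ?_
    rw [norm_cexp_weightedNorm]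
    simp only [zero_mul, Real.exp_zero]
    rfl

theorem prod_cpow_prefactor {d : Fin 24 → ℤ} (hd : ∀ k, 0 < d k) {u : Fin 24 → ℝ}
    (hu : ∑ k, u k = 0) (s : ℝ) (τ : ℂ) :
    ∏ k, 1 / (-I * ((Real.exp (s * u k) / d k : ℝ) * τ)) ^ (1 / 2 : ℂ) =
      (∏ k, √(d k : ℝ) : ℝ) * (τ ^ 12)⁻¹ := by
  have hdr : ∀ k, (0 : ℝ) < d k := fun k => by exact_mod_cast hd k
  have h1 : ∀ k, 1 / (-I * ((Real.exp (s * u k) / d k : ℝ) * τ)) ^ (1 / 2 : ℂ) =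
      ((√(d k) : ℝ) * (Real.exp (-(s / 2) * u k) : ℝ) : ℂ) * ((-I * τ) ^ (1 / 2 : ℂ))⁻¹ := by
    intro k
    rw [neg_I_mul_cpow_half _ (div_pos (Real.exp_pos _) (hdr k)), one_div, mul_inv,
      Real.sqrt_div (Real.exp_pos _).le, ← Complex.ofReal_inv, inv_div, ← Complex.ofReal_mul,
      div_eq_mul_inv, ← Real.exp_half, ← Real.exp_neg]
    congr 4
    ring
  have h2 : ((-I * τ) ^ (1 / 2 : ℂ)) ^ 24 = τ ^ 12 := by
    rw [show (24 : ℕ) = 2 * 12 from rfl, pow_mul, ← Complex.cpow_nat_mul]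
    norm_num [mul_pow]
    rw [show (12 : ℕ) = 4 * 3 from rfl, pow_mul, Complex.I_pow_four]
    simp
  simp only [h1]
  rw [Finset.prod_mul_distrib, Finset.prod_mul_distrib, Finset.prod_const, Finset.card_univ,
    Fintype.card_fin, inv_pow, h2, ← Complex.ofReal_prod, ← Complex.ofReal_prod, ← Real.exp_sum,
    ← Finset.mul_sum, hu]
  simp

theorem weightedTheta_neg_inv {d : Fin 24 → ℤ} {Λ : AddSubgroup (Fin 24 → ℤ)}
    (hd : ∀ k, 0 < d k) (hmem : ∀ k, Pi.single k (d k) ∈ Λ)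
    (hint : ∀ x ∈ Λ, ∀ y ∈ Λ, ∃ m : ℤ, diagForm d x y = m)
    (hdual : ∀ y, (∀ x ∈ Λ, ∃ m : ℤ, diagForm d x y = m) → y ∈ Λ)
    {u : Fin 24 → ℝ} (hu : ∑ k, u k = 0) {τ : ℂ} (hτ : 0 < τ.im) :
    ((latticeReps d Λ).card : ℂ) * weightedTheta d Λ u τ =
      (∏ k, √(d k : ℝ) : ℝ) * (τ ^ 14)⁻¹ * weightedTheta d Λ u (-1 / τ) := by
  have hτ0 : τ ≠ 0 := by rintro rfl; simp at hτ
  have hτ' : 0 < (-1 / τ).im := by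
    rw [neg_div, neg_im, one_div, inv_im, neg_div, neg_neg]
    exact div_pos hτ (normSq_pos.2 hτ0)
  have h := fun s : ℝ => theta_transform hd hmem hint hdual (fun k => Real.exp (s * u k))
    (fun k => Real.exp_pos _) hτ
  simp only [prod_cpow_prefactor hd hu] at h
  have h1 := (hasDerivAt_theta_deformation (Λ := Λ) hd u hτ).const_mul
    ((latticeReps d Λ).card : ℂ)
  have h2 := (HasDerivAt.scomp (0 : ℝ) (h := fun s : ℝ => -s) (h' := -1)
    (by simpa using hasDerivAt_theta_deformation (Λ := Λ) hd u hτ')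
    (hasDerivAt_neg 0)).const_mul ((∏ k, √(d k : ℝ) : ℝ) * (τ ^ 12)⁻¹ : ℂ)
  have h3 := h1.unique (h2.congr_of_eventuallyEq (Filter.Eventually.of_forall fun s => ?_))
  · have hpi : (Real.pi : ℂ) ≠ 0 := by simp [Real.pi_ne_zero]
    simp only [neg_smul, one_smul] at h3
    have h4 : (Real.pi * I * τ) * ((latticeReps d Λ).card * weightedTheta d Λ u τ) =
      (Real.pi * I * τ) * ((∏ k, √(d k : ℝ) : ℝ) * (τ ^ 14)⁻¹ * weightedTheta d Λ u (-1 / τ)) := by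
      rw [mul_left_comm, h3]
      field_simp
    exact mul_left_cancel₀ (by simp [hpi, hτ0]) h4
  · simp only [h s, Function.comp_apply, neg_mul, Real.exp_neg]

end Lattice

section Lattice

open Complex Filter Topology
open UpperHalfPlane hiding I

variable {n : ℕ} {d : Fin n → ℤ} {Λ : AddSubgroup (Fin n → ℤ)}

theorem abs_weightedNorm_le_sum (hd : ∀ k, 0 < d k) (u : Fin n → ℝ) (x : Fin n → ℤ) :
    |weightedNorm d u x| ≤ (∑ k, |u k|) * weightedNorm d 1 x :=
  abs_weightedNorm_le hd
    (fun k => Finset.single_le_sum (fun i _ => abs_nonneg (u i)) (Finset.mem_univ k)) x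

theorem norm_weightedTheta_term_le (hd : ∀ k, 0 < d k) (u : Fin n → ℝ) {b : ℝ} {τ : ℂ}
    (hb : b ≤ τ.im) (x : Fin n → ℤ) :
    ‖(Λ : Set (Fin n → ℤ)).indicator
      (fun x => weightedNorm d u x * cexp (Real.pi * I * τ * weightedNorm d 1 x)) x‖ ≤
    (∑ k, |u k|) * (weightedNorm d 1 x * Real.exp (-(Real.pi * b) * weightedNorm d 1 x)) := by
  refine (norm_indicator_le_norm_self _ _).trans ?_
  rw [norm_mul, norm_cexp_weightedNorm, norm_real, Real.norm_eq_abs, ← mul_assoc]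
  have h0 := weightedNorm_one_nonneg hd x
  have : -(Real.pi * τ.im) * weightedNorm d 1 x ≤ -(Real.pi * b) * weightedNorm d 1 x := by
    gcongr
  gcongr
  exact abs_weightedNorm_le_sum hd u x

theorem differentiableOn_weightedTheta (hd : ∀ k, 0 < d k) (u : Fin n → ℝ) :
    DifferentiableOn ℂ (weightedTheta d Λ u) {τ | 0 < τ.im} := by
  intro τ hτ
  have hτ : 0 < τ.im := hτ
  have ho : IsOpen {z : ℂ | τ.im / 2 < z.im} := isOpen_lt continuous_const continuous_im
  have hm : τ ∈ {z : ℂ | τ.im / 2 < z.im} := by simp only [Set.mem_ofPred_eq]; linarith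
  have : DifferentiableOn ℂ (weightedTheta d Λ u) {z : ℂ | τ.im / 2 < z.im} := by
    refine differentiableOn_tsum_of_summable_norm
      ((summable_mul_exp_neg_weightedNorm (b := Real.pi * (τ.im / 2)) hd (by positivity)).mul_left
        (∑ k, |u k|)) (fun x => ?_) ho
      fun x w hw => norm_weightedTheta_term_le hd u (le_of_lt hw) x
    by_cases hx : x ∈ (Λ : Set (Fin n → ℤ))
    · simp only [Set.indicator_of_mem hx]
      fun_prop
    · simp only [Set.indicator_of_notMem hx]
      fun_prop
  exact (this.differentiableAt (ho.mem_nhds hm)).differentiableWithinAt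

theorem weightedTheta_add_one (heven : ∀ x ∈ Λ, ∃ m : ℤ, weightedNorm d 1 x = 2 * m)
    (u : Fin n → ℝ) (τ : ℂ) : weightedTheta d Λ u (τ + 1) = weightedTheta d Λ u τ := by
  refine tsum_congr fun x => ?_
  by_cases hx : x ∈ (Λ : Set (Fin n → ℤ))
  · simp only [Set.indicator_of_mem hx]
    obtain ⟨m, hm⟩ := heven x hx
    congr 1
    rw [Complex.exp_eq_exp_iff_exists_int]
    refine ⟨m, ?_⟩
    rw [hm]
    push_cast
    ring
  · simp only [Set.indicator_of_notMem hx]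

theorem tendsto_weightedTheta_atImInfty (hd : ∀ k, 0 < d k) (u : Fin n → ℝ) :
    Tendsto (fun τ : ℍ => weightedTheta d Λ u τ) atImInfty (𝓝 0) := by
  have him : Tendsto UpperHalfPlane.im atImInfty atTop := tendsto_comap
  have : (0 : ℂ) = ∑' _ : Fin n → ℤ, (0 : ℂ) := by simp
  rw [this]
  refine tendsto_tsum_of_dominated_convergence
    ((summable_mul_exp_neg_weightedNorm (b := Real.pi * 1) hd (by positivity)).mul_left
        (∑ k, |u k|)) (fun x => ?_) ?_
  · refine squeeze_zero_norm
      (fun τ : ℍ => norm_weightedTheta_term_le (Λ := Λ) hd u (le_refl (τ : ℂ).im) x) ?_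
    rcases (weightedNorm_one_nonneg hd x).eq_or_lt with h | h
    · simp [← h]
    · rw [show (0 : ℝ) = (∑ k, |u k|) * (weightedNorm d 1 x * 0) by simp]
      refine (Tendsto.const_mul _ (Tendsto.const_mul _ ?_))
      refine Real.tendsto_exp_atBot.comp ?_
      have := him.const_mul_atTop (mul_pos Real.pi_pos h)
      refine (tendsto_neg_atTop_atBot.comp this).congr fun τ => ?_
      simp only [Function.comp, coe_im]
      ring
  · filter_upwards [him.eventually_ge_atTop 1] with τ hτ x
    exact norm_weightedTheta_term_le hd u hτ x

theorem tendsto_weightedTheta_mul_exp (hd : ∀ k, 0 < d k)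
    (heven : ∀ x ∈ Λ, ∃ m : ℤ, weightedNorm d 1 x = 2 * m) (u : Fin n → ℝ)
    {S : Finset (Fin n → ℤ)} (hS : ∀ x, x ∈ S ↔ x ∈ Λ ∧ weightedNorm d 1 x = 2) :
    Tendsto (fun y : ℝ => weightedTheta d Λ u (y * I) * cexp (2 * Real.pi * y)) atTop
      (𝓝 (∑ x ∈ S, weightedNorm d u x : ℝ)) := by
  have hterm : ∀ (y : ℝ) (x : Fin n → ℤ), (Λ : Set (Fin n → ℤ)).indicator
      (fun x => weightedNorm d u x * cexp (Real.pi * I * (y * I) * weightedNorm d 1 x)) x *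
        cexp (2 * Real.pi * y) = (Λ : Set (Fin n → ℤ)).indicator
      (fun x => (weightedNorm d u x * Real.exp (-(Real.pi * y) * (weightedNorm d 1 x - 2)) : ℝ)) x
      := by
    intro y x
    by_cases hx : x ∈ (Λ : Set (Fin n → ℤ))
    · simp only [Set.indicator_of_mem hx]
      push_cast
      rw [mul_assoc, ← Complex.exp_add]
      congr 2
      linear_combination (Real.pi * y * weightedNorm d 1 x : ℂ) * I_sq
    · simp [Set.indicator_of_notMem hx]
  have hsum : ((∑ x ∈ S, weightedNorm d u x : ℝ) : ℂ) =
      ∑' x, (((S : Set (Fin n → ℤ)).indicator (fun x => weightedNorm d u x) x : ℝ) : ℂ) := by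
    rw [← ofReal_tsum, ← tsum_subtype]
    simp [Finset.sum_attach S fun x => (weightedNorm d u x : ℂ)]
  have key (x : Fin n → ℤ) (hx : x ∈ Λ) : weightedNorm d u x = 0 ∨ weightedNorm d 1 x = 2 ∨
      4 ≤ weightedNorm d 1 x := by
    obtain ⟨m, hm⟩ := heven x hx
    have h0 := weightedNorm_one_nonneg hd x
    have h1 := abs_weightedNorm_le_sum hd u x
    rw [hm] at h0 h1 ⊢
    have hm0 : 0 ≤ m := by exact_mod_cast (by linarith : (0 : ℝ) ≤ m)
    obtain rfl | rfl | hm2 : m = 0 ∨ m = 1 ∨ 2 ≤ m := by omega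
    · left; simpa using h1
    · right; left; simp
    · right; right
      have : (2 : ℝ) ≤ m := by exact_mod_cast hm2
      linarith
  rw [hsum]
  simp only [weightedTheta, ← tsum_mul_right, hterm]
  refine tendsto_tsum_of_dominated_convergence
    (((summable_mul_exp_neg_weightedNorm (b := Real.pi / 2) hd (by positivity)).mul_left
        (∑ k, |u k|)).mul_left (Real.exp Real.pi)) (fun x => ?_) ?_
  · refine (continuous_ofReal.tendsto _).comp ?_
    by_cases hx : x ∈ (Λ : Set (Fin n → ℤ))
    · simp only [Set.indicator_of_mem hx]
      rcases key x hx with h | h | h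
      · simp [h, Set.indicator_apply]
      · rw [Set.indicator_of_mem (by simpa using (hS x).2 ⟨hx, h⟩)]
        simp [h]
      · rw [Set.indicator_of_notMem (by
          simp only [Finset.mem_coe, hS, not_and]; intro _ h'; linarith)]
        rw [show 𝓝 (0 : ℝ) = 𝓝 (weightedNorm d u x * 0) by simp]
        refine Tendsto.const_mul _ (Real.tendsto_exp_atBot.comp ?_)
        have := tendsto_id.const_mul_atTop (show 0 < Real.pi * (weightedNorm d 1 x - 2) from
          mul_pos Real.pi_pos (by linarith))
        refine (tendsto_neg_atTop_atBot.comp this).congr fun τ => ?_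
        simp only [Function.comp, id]
        ring
    · rw [Set.indicator_of_notMem (by
          simp only [Finset.mem_coe, hS, not_and]; intro h'; exact absurd h' hx)]
      simp [Set.indicator_of_notMem hx]
  · filter_upwards [eventually_ge_atTop 1] with y hy x
    rw [norm_real, Real.norm_eq_abs]
    have h0 := weightedNorm_one_nonneg hd x
    have hM := abs_weightedNorm_le_sum hd u x
    have hM0 : 0 ≤ ∑ k, |u k| := Finset.sum_nonneg fun k _ => abs_nonneg _
    by_cases hx : x ∈ (Λ : Set (Fin n → ℤ))
    · rw [Set.indicator_of_mem hx, abs_mul, Real.abs_exp]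
      by_cases h2 : 2 ≤ weightedNorm d 1 x
      · have : Real.exp (-(Real.pi * y) * (weightedNorm d 1 x - 2)) ≤
            Real.exp Real.pi * Real.exp (-(Real.pi / 2) * weightedNorm d 1 x) := by
          rw [← Real.exp_add, Real.exp_le_exp]
          have := mul_nonneg (mul_nonneg Real.pi_pos.le (sub_nonneg.2 hy)) (sub_nonneg.2 h2)
          have := mul_nonneg Real.pi_pos.le (sub_nonneg.2 h2)
          nlinarith
        calc _ ≤ ((∑ k, |u k|) * weightedNorm d 1 x) *
              (Real.exp Real.pi * Real.exp (-(Real.pi / 2) * weightedNorm d 1 x)) := by gcongr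
          _ = _ := by ring
      · have : weightedNorm d u x = 0 := by
          rcases key x hx with h | h | h
          · exact h
          · exact absurd h.ge h2
          · exact absurd (by linarith) h2
        rw [this, abs_zero, zero_mul]
        positivity
    · rw [Set.indicator_of_notMem hx, abs_zero]
      positivity

end Lattice

section Lattice

open Complex Filter Topology ModularForm SlashInvariantForm MatrixGroups
open UpperHalfPlane hiding I

theorem cuspForm_weight_fourteen_eq_zero (f : CuspForm 𝒮ℒ 14) : f = 0 := by
  have h : Module.rank ℂ (CuspForm 𝒮ℒ 14) = 0 :=
    CuspForm.discriminantEquiv.rank_eq.trans (by simpa using! levelOne_weight_two_rank_zero)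
  exact rank_zero_iff_forall_zero.1 h f

variable {d : Fin 24 → ℤ} {Λ : AddSubgroup (Fin 24 → ℤ)}

theorem eq_zero_of_level_one_weight_fourteen {F : ℂ → ℂ}
    (hF : DifferentiableOn ℂ F {τ | 0 < τ.im}) (hT : ∀ τ, F (τ + 1) = F τ)
    (hS : ∀ τ : ℂ, 0 < τ.im → F (-1 / τ) = τ ^ 14 * F τ)
    (hzero : Tendsto (fun τ : ℍ => F τ) atImInfty (𝓝 0)) {τ : ℂ} (hτ : 0 < τ.im) : F τ = 0 := by
  set G : ℍ → ℂ := fun τ => F τ with hG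
  have hGT : G ∣[(14 : ℤ)] ModularGroup.T = G := by
    ext z
    rw [SL_slash_apply, modular_T_smul, ModularGroup.denom_apply]
    simp [G, ModularGroup.T, add_comm (1 : ℂ), hT]
  have hGS : G ∣[(14 : ℤ)] ModularGroup.S = G := by
    ext z
    suffices F (-(↑z)⁻¹) * ((z : ℂ) ^ 14)⁻¹ = F z by
      rw [SL_slash_apply, UpperHalfPlane.modular_S_smul, ModularGroup.denom_S]
      simpa only [G, zpow_neg, UpperHalfPlane.coe_mk, inv_neg] using! this
    have := hS z z.2
    rw [neg_div, one_div] at this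
    rw [this]
    field_simp [z.ne_zero]
  let f : CuspForm 𝒮ℒ 14 :=
    { toFun := G
      slash_action_eq' := fun A hA => by
        obtain ⟨A, rfl⟩ := hA
        exact slash_action_generators_SL2Z hGS hGT A
      holo' := by
        rw [UpperHalfPlane.mdifferentiable_iff]
        refine hF.congr fun z hz => ?_
        simp [G, ofComplex_apply_of_im_pos hz]
      zero_at_cusps' := fun hc => by
        rw [Subgroup.IsArithmetic.isCusp_iff_isCusp_SL2Z] at hc
        rw [OnePoint.isZeroAt_iff_forall_SL2Z hc]
        intro γ _
        rw [slash_action_generators_SL2Z hGS hGT]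
        exact hzero }
  have := DFunLike.congr_fun (cuspForm_weight_fourteen_eq_zero f) ⟨τ, hτ⟩
  exact this

theorem weightedTheta_eq_zero (hd : ∀ k, 0 < d k) (hmem : ∀ k, Pi.single k (d k) ∈ Λ)
    (hint : ∀ x ∈ Λ, ∀ y ∈ Λ, ∃ m : ℤ, diagForm d x y = m)
    (hdual : ∀ y, (∀ x ∈ Λ, ∃ m : ℤ, diagForm d x y = m) → y ∈ Λ)
    (heven : ∀ x ∈ Λ, ∃ m : ℤ, weightedNorm d 1 x = 2 * m)
    {u : Fin 24 → ℝ} (hu : ∑ k, u k = 0) {τ : ℂ} (hτ : 0 < τ.im) : weightedTheta d Λ u τ = 0 := by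
  have him {τ : ℂ} (hτ : 0 < τ.im) : 0 < (-1 / τ).im := by
    have := UpperHalfPlane.im_inv_neg_coe_pos ⟨τ, hτ⟩
    simpa [neg_div, inv_neg] using this
  have hinv {τ : ℂ} (hτ : 0 < τ.im) := weightedTheta_neg_inv hd hmem hint hdual hu hτ
  have hP : (0 : ℝ) < ∏ k, √(d k : ℝ) :=
    Finset.prod_pos fun k _ => Real.sqrt_pos.2 (by exact_mod_cast hd k)
  have hc : 0 < (latticeReps d Λ).card := by
    refine Finset.card_pos.2 ⟨0, mem_latticeReps.2 ⟨fun k => ?_, Λ.zero_mem⟩⟩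
    simpa using hd k
  generalize (latticeReps d Λ).card = c at hinv hc
  generalize ∏ k, √(d k : ℝ) = P at hinv hP
  by_contra hne
  have hcP : (c : ℂ) = P := by
    have h1 := hinv hτ
    have h2 := hinv (him hτ)
    have hτ0 : τ ≠ 0 := by rintro rfl; simp at hτ
    rw [show -1 / (-1 / τ) = τ by field_simp] at h2
    have h3 : (c : ℂ) ^ 2 = (P : ℂ) ^ 2 := by
      refine mul_right_cancel₀ hne ?_
      calc (c : ℂ) ^ 2 * weightedTheta d Λ u τ = c * (c * weightedTheta d Λ u τ) := by ring
        _ = P * (τ ^ 14)⁻¹ * (c * weightedTheta d Λ u (-1 / τ)) := by rw [h1]; ring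
        _ = _ := by rw [h2]; field_simp
    have h4 : (c : ℝ) ^ 2 = P ^ 2 := by exact_mod_cast h3
    exact_mod_cast (pow_left_inj₀ (Nat.cast_nonneg c) hP.le two_ne_zero).1 h4
  refine hne (eq_zero_of_level_one_weight_fourteen (differentiableOn_weightedTheta hd u)
    (weightedTheta_add_one heven u) (fun z hz => ?_) (tendsto_weightedTheta_atImInfty hd u) hτ)
  have h1 := hinv hz
  have hz0 : z ≠ 0 := by rintro rfl; simp at hz
  have hc0 : (c : ℂ) ≠ 0 := by exact_mod_cast hc.ne'
  rw [← hcP, mul_assoc] at h1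
  rw [mul_left_cancel₀ hc0 h1]
  field_simp

theorem sum_weightedNorm_eq_zero (hd : ∀ k, 0 < d k) (hmem : ∀ k, Pi.single k (d k) ∈ Λ)
    (hint : ∀ x ∈ Λ, ∀ y ∈ Λ, ∃ m : ℤ, diagForm d x y = m)
    (hdual : ∀ y, (∀ x ∈ Λ, ∃ m : ℤ, diagForm d x y = m) → y ∈ Λ)
    (heven : ∀ x ∈ Λ, ∃ m : ℤ, weightedNorm d 1 x = 2 * m)
    {u : Fin 24 → ℝ} (hu : ∑ k, u k = 0) {S : Finset (Fin 24 → ℤ)}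
    (hS : ∀ x, x ∈ S ↔ x ∈ Λ ∧ weightedNorm d 1 x = 2) : ∑ x ∈ S, weightedNorm d u x = 0 := by
  have h := tendsto_weightedTheta_mul_exp hd heven u hS
  have h0 : Tendsto (fun y : ℝ => weightedTheta d Λ u (y * I) * cexp (2 * Real.pi * y)) atTop
      (𝓝 0) := by
    refine tendsto_const_nhds.congr' ?_
    filter_upwards [eventually_gt_atTop 0] with y hy
    rw [weightedTheta_eq_zero hd hmem hint hdual heven hu (by simpa using hy), zero_mul]
  exact_mod_cast tendsto_nhds_unique h h0

end Lattice

section RationalForm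

variable {V : Type*} [AddCommGroup V] [Module ℚ V]

open Module Submodule in
/-- A non-isotropic vector is the first member of an orthogonal basis. -/
theorem exists_orthogonal_basis_zero_eq [FiniteDimensional ℚ V] {d : ℕ}
    (hd : finrank ℚ V = d + 1) {B : V →ₗ[ℚ] V →ₗ[ℚ] ℚ} (hsymm : ∀ x y, B x y = B y x) {x : V}
    (hx : B x x ≠ 0) :
    ∃ b : Basis (Fin (d + 1)) ℚ V, b 0 = x ∧ ∀ i j, i ≠ j → B (b i) (b j) = 0 := by
  let W := LinearMap.ker (B x)
  have hmemW {y : V} : y ∈ W ↔ B x y = 0 := LinearMap.mem_ker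
  have hW : finrank ℚ W = d := by
    have h := (B x).finrank_range_add_finrank_ker
    rw [LinearMap.range_eq_top.2 (LinearMap.surjective fun h => hx (by rw [h]; rfl)), finrank_top,
      finrank_self, hd] at h
    exact (Nat.add_left_cancel (h.trans (add_comm d 1)))
  let B' : LinearMap.BilinForm ℚ W := B.domRestrict₁₂ W W
  have : Invertible (2 : ℚ) := invertibleOfNonzero two_ne_zero
  obtain ⟨v', hv'⟩ := LinearMap.BilinForm.exists_orthogonal_basis (B := B')
    ⟨fun y z => hsymm y z⟩
  let v := v'.reindex (finCongr hW)
  have hv (i j) (hij : i ≠ j) : B (v i) (v j) = 0 := by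
    simp only [v, Basis.reindex_apply]
    exact hv' fun h => hij ((finCongr hW).symm.injective h)
  refine ⟨Basis.mkFinCons x v (fun c y hy hc => ?_) fun y => ⟨-B x y / B x x, ?_⟩, ?_, ?_⟩
  · have := congrArg (B x) hc
    rw [map_add, map_smul, hmemW.1 hy, add_zero, map_zero, smul_eq_mul] at this
    exact (mul_eq_zero.1 this).resolve_right hx
  · rw [hmemW, map_add, map_smul, smul_eq_mul, div_mul_cancel₀ _ hx, add_neg_cancel]
  · simp
  · rw [Basis.coe_mkFinCons]
    intro i j
    refine Fin.cases ?_ (fun i => ?_) i <;> refine Fin.cases ?_ (fun j => ?_) j <;> intro hij <;>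
      simp only [Fin.cons_zero, Fin.cons_succ, Function.comp_apply]
    · exact (hij rfl).elim
    · exact hmemW.1 (v j).2
    · rw [hsymm]
      exact hmemW.1 (v i).2
    · exact hv i j fun h => hij (h ▸ rfl)

theorem exists_nsmul_mem (L : Submodule ℤ V) (hspan : Submodule.span ℚ (L : Set V) = ⊤) (v : V) :
    ∃ m : ℤ, m ≠ 0 ∧ m • v ∈ L := by
  have hv : v ∈ Submodule.span ℚ (L : Set V) := hspan ▸ Submodule.mem_top
  induction hv using Submodule.span_induction with
  | mem x hx => exact ⟨1, one_ne_zero, by simpa using hx⟩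
  | zero => exact ⟨1, one_ne_zero, by simp⟩
  | add x y _ _ hx hy =>
    obtain ⟨m, hm, hx⟩ := hx
    obtain ⟨k, hk, hy⟩ := hy
    refine ⟨m * k, mul_ne_zero hm hk, ?_⟩
    rw [smul_add]
    refine L.add_mem ?_ ?_
    · rw [mul_comm, mul_smul]
      exact L.smul_mem _ hx
    · rw [mul_smul]
      exact L.smul_mem _ hy
  | smul a x _ hx =>
    obtain ⟨m, hm, hx⟩ := hx
    refine ⟨m * a.den, mul_ne_zero hm (by exact_mod_cast a.den_ne_zero), ?_⟩
    have : (m * a.den : ℤ) • a • x = a.num • m • x := by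
      simp only [← Int.cast_smul_eq_zsmul ℚ, smul_smul]
      congr 1
      push_cast
      rw [mul_assoc, mul_comm (a.den : ℚ), Rat.mul_den_eq_num, mul_comm]
    rw [this]
    exact L.smul_mem _ hx

theorem exists_integral_orthogonal_basis (L : Submodule ℤ V)
    (hspan : Submodule.span ℚ (L : Set V) = ⊤) {n : ℕ} (hrank : Module.finrank ℚ V = n + 1)
    {B : V →ₗ[ℚ] V →ₗ[ℚ] ℚ} (hsymm : ∀ x y, B x y = B y x) {x : V} (hxL : x ∈ L)
    (hx : B x x ≠ 0) :
    ∃ b : Module.Basis (Fin (n + 1)) ℚ V,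
      b 0 = x ∧ (∀ k, b k ∈ L) ∧ ∀ i j, i ≠ j → B (b i) (b j) = 0 := by
  have : FiniteDimensional ℚ V := Module.finite_of_finrank_pos (by omega)
  obtain ⟨b, hb0, hb⟩ := exists_orthogonal_basis_zero_eq hrank hsymm hx
  choose m hm hmL using fun k => exists_nsmul_mem L hspan (b k)
  let w : Fin (n + 1) → ℚ := fun k => if k = 0 then 1 else m k
  have hw (k) : IsUnit (w k) := by
    rw [isUnit_iff_ne_zero]
    by_cases hk : k = 0 <;> simp [w, hk, hm]
  refine ⟨b.isUnitSMul hw, by simp [Module.Basis.isUnitSMul_apply, w, hb0], fun k => ?_,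
    fun i j hij => by simp [Module.Basis.isUnitSMul_apply, hb i j hij]⟩
  rw [Module.Basis.isUnitSMul_apply]
  by_cases hk : k = 0
  · simpa [w, hk, hb0] using hxL
  · simpa [w, hk, Int.cast_smul_eq_zsmul] using hmL k

theorem finite_setOf_mem_of_norm_eq {L : Submodule ℤ V} (hfg : L.FG) {B : V →ₗ[ℚ] V →ₗ[ℚ] ℚ}
    (hsymm : ∀ x y, B x y = B y x) (hint : ∀ x ∈ L, ∀ y ∈ L, ∃ n : ℤ, B x y = n)
    (hpos : ∀ x ∈ L, x ≠ 0 → 0 < B x x) (a : ℚ) : {x | x ∈ L ∧ B x x = a}.Finite := by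
  obtain ⟨s, hs⟩ := hfg
  have hsL (x) (hx : x ∈ s) : x ∈ L := hs ▸ Submodule.subset_span hx
  have hnn (x) (hx : x ∈ L) : 0 ≤ B x x := by
    by_cases h : x = 0
    · simp [h]
    · exact (hpos x hx h).le
  let c : V → s → ℤ := fun v x => ⌊B v x⌋
  have hc (v) (hv : v ∈ L) (x : s) : (c v x : ℚ) = B v x := by
    obtain ⟨m, hm⟩ := hint v hv x (hsL x x.2)
    simp [c, hm]
  refine Set.Finite.of_injOn (f := c) (t := Set.pi Set.univ fun x : s =>
    Set.Icc (-⌈a + B x x⌉) ⌈a + B x x⌉) ?_ ?_ (Set.Finite.pi fun x => Set.finite_Icc _ _)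
  · rintro v ⟨hv, hva⟩ x -
    have hxL := hsL x x.2
    have h1 := hnn _ (L.add_mem hv hxL)
    have h2 := hnn _ (L.sub_mem hv hxL)
    have h3 := hnn _ hv
    have h4 := hnn _ hxL
    simp only [map_add, map_sub, LinearMap.add_apply, LinearMap.sub_apply, hsymm x v, hva]
      at h1 h2 h3
    have h5 := Int.le_ceil (a + B x x)
    constructor
    · have : (-⌈a + B x x⌉ : ℚ) ≤ c v x := by rw [hc v hv]; linarith
      exact_mod_cast this
    · have : (c v x : ℚ) ≤ ⌈a + B x x⌉ := by rw [hc v hv]; linarith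
      exact_mod_cast this
  · rintro v ⟨hv, -⟩ w ⟨hw, -⟩ h
    have hvw : ∀ x ∈ L, B (v - w) x = 0 := by
      intro x hx
      rw [← hs] at hx
      induction hx using Submodule.span_induction with
      | mem x hx =>
        have := congrFun h ⟨x, hx⟩
        rw [map_sub, LinearMap.sub_apply, ← hc v hv ⟨x, hx⟩, ← hc w hw ⟨x, hx⟩, this, sub_self]
      | zero => simp
      | add x y _ _ hx hy => rw [map_add, hx, hy, add_zero]
      | smul k x _ hx => rw [map_zsmul, hx, smul_zero]
    by_contra hne
    exact (hpos _ (L.sub_mem hv hw) (sub_ne_zero.2 hne)).ne' (hvw _ (L.sub_mem hv hw))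

end RationalForm

section RationalForm

variable {V : Type*} [AddCommGroup V] [Module ℚ V]

/-- The roots of an even unimodular lattice of rank 24 form a spherical 2-design. -/
theorem sum_sq_eq_card_div_six (L : Submodule ℤ V)
    (hspan : Submodule.span ℚ (L : Set V) = ⊤) (hrank : Module.finrank ℚ V = 24)
    (B : V →ₗ[ℚ] V →ₗ[ℚ] ℚ) (hsymm : ∀ x y : V, B x y = B y x)
    (hint : ∀ x ∈ L, ∀ y ∈ L, ∃ n : ℤ, B x y = (n : ℚ))
    (hpos : ∀ x ∈ L, x ≠ 0 → 0 < B x x)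
    (heven : ∀ x ∈ L, ∃ n : ℤ, B x x = 2 * (n : ℚ))
    (hunimod : ∀ v : V, (∀ y ∈ L, ∃ n : ℤ, B v y = (n : ℚ)) → v ∈ L)
    {R : Finset V} (hR : ∀ x, x ∈ R ↔ x ∈ L ∧ B x x = 2) {a : V} (ha : a ∈ R) :
    ∑ r ∈ R, B a r ^ 2 = (R.card : ℚ) / 6 := by
  classical
  obtain ⟨haL, ha2⟩ := (hR a).1 ha
  obtain ⟨b, hb0, hbL, hb⟩ := exists_integral_orthogonal_basis L hspan hrank hsymm haL
    (by rw [ha2]; exact two_ne_zero)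
  choose d hd using fun k => hint (b k) (hbL k) (b k) (hbL k)
  have hd0 (k) : 0 < d k := by
    have := hpos _ (hbL k) (b.ne_zero k)
    rw [hd] at this
    exact_mod_cast this
  have hdne (k) : (d k : ℚ) ≠ 0 := by exact_mod_cast (hd0 k).ne'
  let g : (Fin 24 → ℤ) →+ V := AddMonoidHom.mk' (fun y => ∑ k, ((y k : ℚ) / d k) • b k) fun y z => by
    simp only [Pi.add_apply, Int.cast_add, add_div, add_smul, Finset.sum_add_distrib]
  have hg (y) : g y = ∑ k, ((y k : ℚ) / d k) • b k := rfl
  have hgb (y k) : B (g y) (b k) = y k := by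
    rw [hg, map_sum, LinearMap.sum_apply, Finset.sum_eq_single k]
    · rw [map_smul, LinearMap.smul_apply, hd, smul_eq_mul, div_mul_cancel₀ _ (hdne k)]
    · intro i _ hik
      rw [map_smul, LinearMap.smul_apply, hb i k hik, smul_zero]
    · simp
  have hgg (y z) : B (g y) (g z) = ∑ k, (y k : ℚ) * z k / d k := by
    conv_lhs => rw [hg z, map_sum]
    refine Finset.sum_congr rfl fun k _ => ?_
    rw [map_smul, hgb, smul_eq_mul]
    ring
  let c : V → Fin 24 → ℤ := fun v k => ⌊B v (b k)⌋
  have hcb (v) (hv : v ∈ L) (k) : (c v k : ℚ) = B v (b k) := by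
    obtain ⟨m, hm⟩ := hint v hv (b k) (hbL k)
    simp [c, hm]
  have hcg (y) : c (g y) = y := by
    ext k
    simp [c, hgb]
  have hgc (v) (hv : v ∈ L) : g (c v) = v := by
    have h (w) : (∀ k, B w (b k) = 0) → w = 0 := by
      intro hw
      rw [← b.sum_repr w]
      refine Finset.sum_eq_zero fun k _ => ?_
      have := hw k
      rw [← b.sum_repr w, map_sum, LinearMap.sum_apply, Finset.sum_eq_single k] at this
      · rw [map_smul, LinearMap.smul_apply, hd, smul_eq_mul] at this
        rw [(mul_eq_zero.1 this).resolve_right (hdne k), zero_smul]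
      · intro i _ hik
        rw [map_smul, LinearMap.smul_apply, hb i k hik, smul_zero]
      · simp
    refine sub_eq_zero.1 (h _ fun k => ?_)
    rw [map_sub, LinearMap.sub_apply, hgb, hcb v hv, sub_self]
  let Λ : AddSubgroup (Fin 24 → ℤ) := L.toAddSubgroup.comap g
  have hΛ (y) : y ∈ Λ ↔ g y ∈ L := Iff.rfl
  have hdiag (y z) : diagForm d y z = (B (g y) (g z) : ℚ) := by
    rw [hgg, diagForm]
    push_cast
    rfl
  have hnorm (y) : weightedNorm d 1 y = (B (g y) (g y) : ℚ) := by
    rw [hgg, weightedNorm]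
    push_cast
    exact Finset.sum_congr rfl fun k _ => by simp [sq]
  have hmem (k) : Pi.single k (d k) ∈ Λ := by
    rw [hΛ, hg, Finset.sum_eq_single k]
    · rw [Pi.single_eq_same, div_self (hdne k), one_smul]
      exact hbL k
    · intro i _ hik
      simp [hik]
    · simp
  have hint' : ∀ x ∈ Λ, ∀ y ∈ Λ, ∃ m : ℤ, diagForm d x y = m := fun x hx y hy => by
    obtain ⟨m, hm⟩ := hint _ hx _ hy
    exact ⟨m, by rw [hdiag, hm, Rat.cast_intCast]⟩
  have heven' : ∀ x ∈ Λ, ∃ m : ℤ, weightedNorm d 1 x = 2 * m := fun x hx => by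
    obtain ⟨m, hm⟩ := heven _ hx
    exact ⟨m, by rw [hnorm, hm]; push_cast; rfl⟩
  have hdual : ∀ y, (∀ x ∈ Λ, ∃ m : ℤ, diagForm d x y = m) → y ∈ Λ := fun y hy => by
    refine hunimod _ fun w hw => ?_
    obtain ⟨m, hm⟩ := hy (c w) (by rwa [hΛ, hgc w hw])
    rw [hdiag, hgc w hw, hsymm] at hm
    exact ⟨m, by exact_mod_cast hm⟩
  have hS (x) : x ∈ R.image c ↔ x ∈ Λ ∧ weightedNorm d 1 x = 2 := by
    rw [hΛ, hnorm, Finset.mem_image]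
    constructor
    · rintro ⟨v, hv, rfl⟩
      obtain ⟨hvL, hv2⟩ := (hR v).1 hv
      rw [hgc v hvL, hv2]
      exact ⟨hvL, by norm_num⟩
    · rintro ⟨hx, hx2⟩
      exact ⟨g x, (hR _).2 ⟨hx, by exact_mod_cast hx2⟩, hcg x⟩
  have hinj : Set.InjOn c R := fun v hv w hw h => by
    rw [← hgc v ((hR v).1 hv).1, ← hgc w ((hR w).1 hw).1, h]
  have hconst (i) : ∑ r ∈ R, B r (b i) ^ 2 / d i = ∑ r ∈ R, B r (b 0) ^ 2 / d 0 := by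
    let u : Fin 24 → ℚ := fun k => (if k = i then 1 else 0) - (if k = 0 then 1 else 0)
    have hu : ∑ k, ((u k : ℚ) : ℝ) = 0 := by
      rw [← Rat.cast_sum]
      simp [u]
    have h := sum_weightedNorm_eq_zero hd0 hmem hint' hdual heven' hu hS
    rw [Finset.sum_image hinj] at h
    have h' : ∑ r ∈ R, ∑ k, u k * B r (b k) ^ 2 / d k = 0 := by
      rw [← Rat.cast_inj (α := ℝ), Rat.cast_zero, ← h, Rat.cast_sum]
      refine Finset.sum_congr rfl fun r hr => ?_
      simp only [← hcb r ((hR r).1 hr).1, weightedNorm]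
      push_cast
      rfl
    rw [← sub_eq_zero, ← Finset.sum_sub_distrib, ← h']
    refine Finset.sum_congr rfl fun r _ => ?_
    simp [u, sub_mul, sub_div, Finset.sum_sub_distrib, ite_mul, ite_div]
  have htot : ∑ i, ∑ r ∈ R, B r (b i) ^ 2 / d i = 2 * R.card := by
    rw [Finset.sum_comm, mul_comm, ← nsmul_eq_mul, ← Finset.sum_const]
    refine Finset.sum_congr rfl fun r hr => ?_
    obtain ⟨hrL, hr2⟩ := (hR r).1 hr
    rw [← hr2, ← hgc r hrL, hgg, hgc r hrL]
    exact Finset.sum_congr rfl fun k _ => by rw [hcb r hrL, sq]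
  have hd2 : (d 0 : ℚ) = 2 := by rw [← hd, hb0, ha2]
  simp only [hconst, hb0, hd2, Finset.sum_const, Finset.card_univ, Fintype.card_fin,
    ← Finset.sum_div, nsmul_eq_mul] at htot
  simp only [hsymm a]
  push_cast at htot
  linarith

end RationalForm

/-- If `N` is a Niemeier lattice (even unimodular positive definite of rank 24) with a
nonempty set of roots `R`, and `ρ` is its Weyl vector, then `288·B(ρ,ρ) = |R|·(|R|+24)`,
i.e. `B(ρ,ρ) = 2h(h+1)` where `h = |R|/24` is the Coxeter number. -/
theorem niemeier_weyl_vector_norm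
    (V : Type*) [AddCommGroup V] [Module ℚ V]
    (L : Submodule ℤ V) (hfg : L.FG)
    (hspan : Submodule.span ℚ (L : Set V) = ⊤)
    (hrank : Module.finrank ℚ V = 24)
    (B : V →ₗ[ℚ] V →ₗ[ℚ] ℚ)
    (hsymm : ∀ x y : V, B x y = B y x)
    (hint : ∀ x ∈ L, ∀ y ∈ L, ∃ n : ℤ, B x y = (n : ℚ))
    (hpos : ∀ x ∈ L, x ≠ 0 → 0 < B x x)
    (heven : ∀ x ∈ L, ∃ n : ℤ, B x x = 2 * (n : ℚ))
    (hunimod : ∀ v : V, (∀ y ∈ L, ∃ n : ℤ, B v y = (n : ℚ)) → v ∈ L)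
    (hne : {x : V | x ∈ L ∧ B x x = 2}.Nonempty)
    (f : V →ₗ[ℚ] ℚ)
    (hf : ∀ x ∈ L, B x x = 2 → f x ≠ 0)
    (ρ : V)
    (hρ : ρ = (2⁻¹ : ℚ) • ∑ᶠ x ∈ {x : V | x ∈ L ∧ B x x = 2 ∧ 0 < f x}, x) :
    (288 : ℚ) * B ρ ρ =
      ({x : V | x ∈ L ∧ B x x = 2}.ncard : ℚ) *
        (({x : V | x ∈ L ∧ B x x = 2}.ncard : ℚ) + 24) := by
  have hfin := finite_setOf_mem_of_norm_eq hfg hsymm hint hpos 2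
  set R : Finset V := hfin.toFinset with hRdef
  have hR (x) : x ∈ R ↔ x ∈ L ∧ B x x = 2 := by simp [R]
  have hcard : {x : V | x ∈ L ∧ B x x = 2}.ncard = R.card := Set.ncard_eq_toFinset_card _ hfin
  have hsum : ∑ᶠ x ∈ {x : V | x ∈ L ∧ B x x = 2 ∧ 0 < f x}, x = ∑ x ∈ R with 0 < f x, x := by
    rw [← finsum_mem_coe_finset]
    congr! 3 with x
    simp [hR, and_assoc]
  have hnn (x) (hx : x ∈ L) : 0 ≤ B x x ∧ (B x x = 0 → x = 0) := by
    by_cases h : x = 0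
    · simp [h]
    · exact ⟨(hpos x hx h).le, fun h' => absurd h' (hpos x hx h).ne'⟩
  rw [hcard, hρ, hsum]
  refine weyl_vector_norm_of_design B hsymm R (fun r hr => ((hR r).1 hr).2) (fun r hr => ?_)
    (fun a ha b hb hab => ?_) (fun a ha b hb => ?_)
    (fun a ha => sum_sq_eq_card_div_six L hspan hrank B hsymm hint hpos heven hunimod hR ha) f
    fun r hr => hf r ((hR r).1 hr).1 ((hR r).1 hr).2
  · obtain ⟨hrL, hr2⟩ := (hR r).1 hr
    exact (hR _).2 ⟨L.neg_mem hrL, by simpa using hr2⟩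
  · obtain ⟨haL, ha2⟩ := (hR a).1 ha
    obtain ⟨hbL, hb2⟩ := (hR b).1 hb
    refine (hR _).2 ⟨L.add_mem haL hbL, ?_⟩
    simp only [map_add, LinearMap.add_apply, hsymm b a, ha2, hb2, hab]
    norm_num
  · obtain ⟨haL, ha2⟩ := (hR a).1 ha
    obtain ⟨hbL, hb2⟩ := (hR b).1 hb
    obtain ⟨m, hm⟩ := hint a haL b hbL
    obtain ⟨h1, h1'⟩ := hnn _ (L.add_mem haL hbL)
    obtain ⟨h2, h2'⟩ := hnn _ (L.sub_mem haL hbL)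
    simp only [map_add, map_sub, LinearMap.add_apply, LinearMap.sub_apply, hsymm b a, ha2, hb2, hm]
      at h1 h1' h2 h2' ⊢
    have hl : -2 ≤ m := by exact_mod_cast (by linarith : (-2 : ℚ) ≤ m)
    have hu : m ≤ 2 := by exact_mod_cast (by linarith : (m : ℚ) ≤ 2)
    interval_cases m
    · exact Or.inr (Or.inl (eq_neg_of_add_eq_zero_left (h1' (by norm_num))))
    · simp
    · simp
    · simp
    · exact Or.inl (sub_eq_zero.1 (h2' (by norm_num)))
end
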